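/- arXiv:1908.09439 — 4 statements merged into one kernel-verified Lean document; each statement's English description precedes it below -/
import Mathlib

section
/- (Pólya–Vinogradov) There is an absolute constant C such that for every non-principal Dirichlet character χ modulo q ≥ 2 and all integers M and N ≥ 1, | Σ_{M < n ≤ M+N} χ(n) | ≤ C q^{1/2} log q. -/
open Finset

lemma pv_geom (f : ℤ → ℂ) (z : ℂ) (hf : ∀ n, f (n + 1) = z * f n) (h1 : ∀ n, ‖f n‖ = 1)
    (a b : ℤ) : ‖z - 1‖ * ‖∑ n ∈ Finset.Ioc a b, f n‖ ≤ 2 := by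
  rcases le_total b a with hab | hab
  · simp [Finset.Ioc_eq_empty_of_le hab]
  obtain ⟨N, rfl⟩ := Int.le.dest hab
  have key : ∀ N : ℕ, (z - 1) * ∑ n ∈ Finset.Ioc a (a + N), f n = f (a + N + 1) - f (a + 1) := by
    intro N
    induction N with
    | zero => simp
    | succ k ih =>
      have : Finset.Ioc a (a + ((k + 1 : ℕ) : ℤ)) = insert (a + k + 1) (Finset.Ioc a (a + k)) := by
        ext x
        simp only [Finset.mem_Ioc, Finset.mem_insert]
        push_cast
        omega
      rw [this, Finset.sum_insert (by simp), mul_add, ih, sub_mul, ← hf]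
      push_cast
      rw [← add_assoc]
      ring
  rw [← norm_mul, key]
  calc _ ≤ ‖f (a + N + 1)‖ + ‖f (a + 1)‖ := norm_sub_le _ _
    _ = 2 := by rw [h1, h1]; norm_num

lemma pv_sin (d j : ℕ) (hj : 0 < j) (hjd : j < d) :
    1 / Real.sin (Real.pi * j / d) ≤ d / 2 * ((j : ℝ)⁻¹ + ((d : ℝ) - j)⁻¹) := by
  have hd : (0 : ℝ) < d := by exact_mod_cast hj.trans hjd
  have hj' : (0 : ℝ) < j := by exact_mod_cast hj
  have hjd' : (0 : ℝ) < (d : ℝ) - j := by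
    have : (j : ℝ) < d := by exact_mod_cast hjd
    linarith
  have hpi := Real.pi_pos
  have aux : ∀ x : ℝ, 0 < x → x ≤ d / 2 →
      1 / Real.sin (Real.pi * x / d) ≤ d / 2 * x⁻¹ := by
    intro x hx hx2
    have h := Real.mul_le_sin (x := Real.pi * x / d) (by positivity) (by
      rw [div_le_iff₀ hd]; nlinarith)
    have e : 2 / Real.pi * (Real.pi * x / d) = 2 * x / d := by field_simp
    rw [e] at h
    calc _ ≤ 1 / (2 * x / d) := one_div_le_one_div_of_le (by positivity) h
      _ = _ := by field_simp
  rcases le_total (j : ℝ) (d / 2) with h | h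
  · refine (aux j hj' h).trans ?_
    gcongr
    have := inv_pos.2 hjd'
    linarith
  · have := aux (d - j) hjd' (by linarith)
    have e : Real.pi * ((d : ℝ) - j) / d = Real.pi - Real.pi * j / d := by field_simp
    rw [e, Real.sin_pi_sub] at this
    refine this.trans ?_
    gcongr
    have := inv_pos.2 hj'
    linarith

lemma pv_exp (d : ℕ) [NeZero d] (k : ZMod d) (hk : k ≠ 0) (a b : ℤ) :
    ‖∑ n ∈ Finset.Ioc a b, ZMod.stdAddChar (k * (n : ZMod d))‖ ≤
      d / 2 * ((k.val : ℝ)⁻¹ + ((d : ℝ) - k.val)⁻¹) := by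
  have hj : 0 < k.val := Nat.pos_of_ne_zero (by simpa using hk)
  have hjd := ZMod.val_lt k
  have hd : (0 : ℝ) < d := by exact_mod_cast hj.trans hjd
  refine le_trans ?_ (pv_sin d k.val hj hjd)
  have h := pv_geom (fun n : ℤ ↦ ZMod.stdAddChar (k * (n : ZMod d))) (ZMod.stdAddChar k)
    (fun n ↦ by simp only [Int.cast_add, Int.cast_one, mul_add, mul_one,
        AddChar.map_add_eq_mul, mul_comm]) (fun n ↦ AddChar.norm_apply _ _) a b
  have hs : 0 < Real.sin (Real.pi * k.val / d) := by
    apply Real.sin_pos_of_pos_of_lt_pi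
    · have : (0 : ℝ) < k.val := by exact_mod_cast hj
      have := Real.pi_pos
      positivity
    · rw [div_lt_iff₀ hd]
      have : (k.val : ℝ) < d := by exact_mod_cast hjd
      exact mul_lt_mul_of_pos_left this Real.pi_pos
  have e : ‖(ZMod.stdAddChar k : ℂ) - 1‖ = 2 * Real.sin (Real.pi * k.val / d) := by
    have h1 : (ZMod.stdAddChar k : ℂ) =
        Complex.exp (Complex.I * ((2 * Real.pi * k.val / d : ℝ) : ℂ)) := by
      have := ZMod.stdAddChar_coe (N := d) (k.val : ℤ)
      rw [Int.cast_natCast, Int.cast_natCast, ZMod.natCast_zmod_val] at this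
      rw [this]
      congr 1
      push_cast
      ring
    rw [h1, Complex.norm_exp_I_mul_ofReal_sub_one,
      show 2 * Real.pi * k.val / d / 2 = Real.pi * k.val / d by ring, Real.norm_eq_abs,
      abs_of_pos (by positivity)]
  rw [e] at h
  rw [le_div_iff₀ hs]
  linarith

lemma pv_gauss (d : ℕ) [NeZero d] (χ : DirichletCharacter ℂ d) (hχ : χ.IsPrimitive) :
    ‖gaussSum χ (ZMod.stdAddChar (N := d))‖ = Real.sqrt d := by
  have h := congr_fun (ZMod.dft_dft (N := d) (χ : ZMod d → ℂ)) (-1)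
  rw [ZMod.dft_apply] at h
  simp only [hχ.fourierTransform_eq_inv_mul_gaussSum, neg_neg, map_one, smul_eq_mul, mul_one,
    mul_neg] at h
  have h2 : ∑ x : ZMod d, ZMod.stdAddChar x * (χ⁻¹ (-x) * gaussSum χ (ZMod.stdAddChar (N := d))) =
     star (gaussSum χ (ZMod.stdAddChar (N := d))) * gaussSum χ (ZMod.stdAddChar (N := d)) := by
    rw [star_gaussSum_eq, gaussSum.eq_def χ⁻¹, Finset.sum_mul]
    refine Fintype.sum_equiv (Equiv.neg _) _ _ fun x ↦ ?_
    simp only [Equiv.neg_apply, AddChar.inv_apply, neg_neg]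
    ring
  rw [h2] at h
  have h3 := congr_arg norm h
  rw [norm_mul, norm_star, Complex.norm_natCast] at h3
  rw [← h3, Real.sqrt_mul_self (norm_nonneg _)]

lemma pv_harm (d : ℕ) : ∑ j ∈ Finset.range d, ((d : ℝ) / 2 * ((j : ℝ)⁻¹ + ((d : ℝ) - j)⁻¹)) ≤
    d * (1 + Real.log d) := by
  have h0 : ∑ j ∈ Finset.range d, ((j : ℝ) + 1)⁻¹ ≤ 1 + Real.log d := by
    have := harmonic_le_one_add_log d
    simpa [harmonic] using this
  have h1 : ∑ j ∈ Finset.range d, ((d : ℝ) - j)⁻¹ = ∑ j ∈ Finset.range d, ((j : ℝ) + 1)⁻¹ := by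
    rw [← Finset.sum_range_reflect]
    refine Finset.sum_congr rfl fun j hj ↦ ?_
    have := Finset.mem_range.1 hj
    rw [Nat.sub_sub, Nat.cast_sub (by omega)]
    push_cast
    congr 1
    ring
  have h2 : ∑ j ∈ Finset.range d, (j : ℝ)⁻¹ ≤ ∑ j ∈ Finset.range d, ((j : ℝ) + 1)⁻¹ := by
    cases d with
    | zero => simp
    | succ m =>
      rw [Finset.sum_range_succ', Finset.sum_range_succ]
      simp
      positivity
  rw [← Finset.mul_sum, Finset.sum_add_distrib, h1]
  have : (0 : ℝ) ≤ d := Nat.cast_nonneg d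
  nlinarith

lemma pv_prim (d : ℕ) [NeZero d] (hd : 2 ≤ d) (χ : DirichletCharacter ℂ d) (hχ : χ.IsPrimitive)
    (a b : ℤ) :
    ‖∑ n ∈ Finset.Ioc a b, χ (n : ZMod d)‖ ≤ Real.sqrt d * (1 + Real.log d) := by
  have hd0 : (0 : ℝ) < d := by exact_mod_cast (by omega : 0 < d)
  have h : (d : ℂ) * ∑ n ∈ Finset.Ioc a b, χ (n : ZMod d) =
      ∑ k : ZMod d, ZMod.dft (χ : ZMod d → ℂ) k *
        ∑ n ∈ Finset.Ioc a b, ZMod.stdAddChar (k * (n : ZMod d)) := by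
    simp_rw [Finset.mul_sum]
    rw [Finset.sum_comm]
    refine Finset.sum_congr rfl fun n _ ↦ ?_
    have h := congr_fun (ZMod.dft_dft (N := d) (χ : ZMod d → ℂ)) (-(n : ZMod d))
    rw [ZMod.dft_apply] at h
    simp only [neg_neg, smul_eq_mul, mul_neg] at h
    rw [← h]
    exact Finset.sum_congr rfl fun k _ ↦ mul_comm _ _
  have h2 : ∀ k : ZMod d, ‖ZMod.dft (χ : ZMod d → ℂ) k *
        ∑ n ∈ Finset.Ioc a b, ZMod.stdAddChar (k * (n : ZMod d))‖ ≤
      Real.sqrt d * (d / 2 * ((k.val : ℝ)⁻¹ + ((d : ℝ) - k.val)⁻¹)) := by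
    intro k
    rw [hχ.fourierTransform_eq_inv_mul_gaussSum, norm_mul, norm_mul, pv_gauss d χ hχ]
    by_cases hk : k = 0
    · subst hk
      rw [neg_zero, DirichletCharacter.map_zero' _ (by omega)]
      simp
      positivity
    · have h1 := DirichletCharacter.norm_le_one χ⁻¹ (-k)
      have h3 := pv_exp d k hk a b
      gcongr
      exact mul_le_of_le_one_left (Real.sqrt_nonneg _) h1
  have h4 : ∑ k : ZMod d, ((d : ℝ) / 2 * ((k.val : ℝ)⁻¹ + ((d : ℝ) - k.val)⁻¹)) =
      ∑ j ∈ Finset.range d, ((d : ℝ) / 2 * ((j : ℝ)⁻¹ + ((d : ℝ) - j)⁻¹)) := by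
    refine Finset.sum_bij' (fun k _ ↦ k.val) (fun j _ ↦ (j : ZMod d)) ?_ ?_ ?_ ?_ ?_
    · intro k _; simpa using ZMod.val_lt k
    · intro j _; simp
    · intro k _; simp
    · intro j hj; exact ZMod.val_cast_of_lt (by simpa using hj)
    · intro k _; rfl
  have h5 : (d : ℝ) * ‖∑ n ∈ Finset.Ioc a b, χ (n : ZMod d)‖ ≤
      d * (Real.sqrt d * (1 + Real.log d)) := by
    calc (d : ℝ) * ‖∑ n ∈ Finset.Ioc a b, χ (n : ZMod d)‖
        = ‖(d : ℂ) * ∑ n ∈ Finset.Ioc a b, χ (n : ZMod d)‖ := by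
          rw [norm_mul, Complex.norm_natCast]
      _ ≤ ∑ k : ZMod d, Real.sqrt d * (d / 2 * ((k.val : ℝ)⁻¹ + ((d : ℝ) - k.val)⁻¹)) := by
          rw [h]; exact norm_sum_le_of_le _ fun k _ ↦ h2 k
      _ ≤ Real.sqrt d * (d * (1 + Real.log d)) := by
          rw [← Finset.mul_sum, h4]
          exact mul_le_mul_of_nonneg_left (pv_harm d) (Real.sqrt_nonneg _)
      _ = _ := by ring
  exact le_of_mul_le_mul_left h5 hd0

lemma pv_divisors (r : ℕ) : (r.divisors.card : ℝ) ≤ 2 * Real.sqrt r := by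
  have h : r.divisors ⊆ Finset.Icc 1 r.sqrt ∪ (Finset.Icc 1 r.sqrt).image (fun e ↦ r / e) := by
    intro e he
    obtain ⟨⟨f, rfl⟩, h0⟩ := Nat.mem_divisors.1 he
    have he0 : 0 < e := Nat.pos_of_ne_zero (by rintro rfl; simp at h0)
    have hf0 : 0 < f := Nat.pos_of_ne_zero (by rintro rfl; simp at h0)
    rw [Finset.mem_union, Finset.mem_image]
    rcases le_total e f with hef | hef
    · left
      exact Finset.mem_Icc.2 ⟨he0, Nat.le_sqrt.2 (Nat.mul_le_mul_left e hef)⟩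
    · right
      exact ⟨f, Finset.mem_Icc.2 ⟨hf0, Nat.le_sqrt.2 (Nat.mul_le_mul_right f hef)⟩,
        Nat.mul_div_cancel _ hf0⟩
  have h2 : r.divisors.card ≤ 2 * r.sqrt := by
    refine (Finset.card_le_card h).trans ((Finset.card_union_le _ _).trans ?_)
    have := Finset.card_image_le (s := Finset.Icc 1 r.sqrt) (f := fun e ↦ r / e)
    simp only [Nat.card_Icc] at *
    omega
  calc (r.divisors.card : ℝ) ≤ 2 * (r.sqrt : ℝ) := by exact_mod_cast h2
    _ ≤ _ := by gcongr; exact Real.nat_sqrt_le_real_sqrt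

lemma pv_moebius (r : ℕ) (hr : r ≠ 0) (n : ℤ) :
    (∑ e ∈ r.divisors, if (e : ℤ) ∣ n then (ArithmeticFunction.moebius e : ℂ) else 0) =
      if IsCoprime n (r : ℤ) then 1 else 0 := by
  have hg : Int.gcd n r ≠ 0 := by
    intro h
    exact hr (by simpa using (Int.gcd_eq_zero_iff.1 h).2)
  rw [← Finset.sum_filter]
  have : r.divisors.filter (fun e : ℕ ↦ (e : ℤ) ∣ n) = (Int.gcd n r).divisors := by
    ext e
    simp only [Finset.mem_filter, Nat.mem_divisors, hr, hg, ne_eq,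
      not_false_eq_true, and_true]
    rw [← Int.natCast_dvd_natCast (m := e) (n := Int.gcd n r), Int.dvd_coe_gcd_iff,
      Int.natCast_dvd_natCast, and_comm]
  rw [this]
  have h := congr_arg (fun f ↦ f (Int.gcd n r))
    (ArithmeticFunction.coe_moebius_mul_coe_zeta (R := ℂ))
  simp only [ArithmeticFunction.coe_mul_zeta_apply, ArithmeticFunction.intCoe_apply,
    ArithmeticFunction.one_apply] at h
  rw [h]
  simp only [Int.isCoprime_iff_gcd_eq_one]

lemma pv_char (q : ℕ) [NeZero q] (χ : DirichletCharacter ℂ q) (r : ℕ) (hr : q = χ.conductor * r)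
    (n : ℤ) :
    χ (n : ZMod q) = (if IsCoprime n (r : ℤ) then 1 else 0) * χ.primitiveCharacter n := by
  by_cases h : IsCoprime n (q : ℤ)
  · have h2 : IsCoprime n (r : ℤ) := by
      rw [hr] at h; push_cast at h; exact h.of_mul_right_right
    rw [if_pos h2, one_mul, χ.primitiveCharacter_apply_of_isCoprime h]
  · rw [(χ.apply_eq_zero_iff n).2 h]
    by_cases h2 : IsCoprime n (r : ℤ)
    · have h3 : ¬ IsCoprime n (χ.conductor : ℤ) := by
        intro h3
        apply h
        have := h3.mul_right h2
        rw [hr]; push_cast; exact this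
      rw [(χ.primitiveCharacter.apply_eq_zero_iff n).2 h3, mul_zero]
    · rw [if_neg h2, zero_mul]

lemma pv_dvd (d : ℕ) [NeZero d] (hd : 2 ≤ d) (χ : DirichletCharacter ℂ d) (hχ : χ.IsPrimitive)
    (a b : ℤ) (e : ℕ) (he : 0 < e) :
    ‖∑ n ∈ Finset.Ioc a b with (e : ℤ) ∣ n, χ (n : ZMod d)‖ ≤ Real.sqrt d * (1 + Real.log d) := by
  have he' : (0 : ℤ) < e := by exact_mod_cast he
  have : ∑ n ∈ Finset.Ioc a b with (e : ℤ) ∣ n, χ (n : ZMod d) =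
      χ (e : ZMod d) * ∑ m ∈ Finset.Ioc (a / e) (b / e), χ (m : ZMod d) := by
    rw [Finset.mul_sum]
    refine Finset.sum_bij' (fun n _ ↦ n / e) (fun m _ ↦ e * m) ?_ ?_ ?_ ?_ ?_
    · intro n hn
      simp only [Finset.mem_filter, Finset.mem_Ioc] at hn ⊢
      obtain ⟨⟨h1, h2⟩, m, rfl⟩ := hn
      rw [Int.mul_ediv_cancel_left _ he'.ne', Int.ediv_lt_iff_lt_mul he', Int.le_ediv_iff_mul_le he',
        mul_comm m]
      exact ⟨h1, h2⟩
    · intro m hm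
      simp only [Finset.mem_filter, Finset.mem_Ioc] at hm ⊢
      rw [Int.ediv_lt_iff_lt_mul he', Int.le_ediv_iff_mul_le he', mul_comm m] at hm
      exact ⟨hm, dvd_mul_right _ _⟩
    · intro n hn
      exact Int.mul_ediv_cancel' (Finset.mem_filter.1 hn).2
    · intro m hm
      exact Int.mul_ediv_cancel_left _ he'.ne'
    · intro n hn
      obtain ⟨m, rfl⟩ := (Finset.mem_filter.1 hn).2
      rw [Int.mul_ediv_cancel_left _ he'.ne', ← map_mul]
      push_cast
      rfl
  rw [this, norm_mul]
  exact (mul_le_of_le_one_left (norm_nonneg _) (χ.norm_le_one _)).trans (pv_prim d hd χ hχ _ _)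

theorem stmt3 :
    ∃ C > 0, ∀ (q : ℕ), 2 ≤ q → ∀ χ : DirichletCharacter ℂ q, χ ≠ 1 →
      ∀ (M : ℤ) (N : ℕ), 1 ≤ N →
        ‖∑ n ∈ Finset.Ioc M (M + N), χ (n : ZMod q)‖ ≤ C * Real.sqrt q * Real.log q := by
  refine ⟨6, by norm_num, fun q hq χ hχ M N _ ↦ ?_⟩
  have : NeZero q := ⟨by omega⟩
  have hd0 : χ.conductor ≠ 0 := χ.conductor_ne_zero
  have : NeZero χ.conductor := ⟨hd0⟩
  have hd1 : χ.conductor ≠ 1 := fun h ↦ hχ (χ.eq_one_iff_conductor_eq_one.2 h)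
  have hd2 : 2 ≤ χ.conductor := by omega
  obtain ⟨r, hr⟩ := χ.conductor_dvd_level
  have hr0 : r ≠ 0 := by rintro rfl; omega
  have hdq : χ.conductor ≤ q := Nat.le_of_dvd (by omega) χ.conductor_dvd_level
  set d := χ.conductor with hd
  have hS : ∑ n ∈ Finset.Ioc M (M + N), χ (n : ZMod q) =
      ∑ e ∈ r.divisors, (ArithmeticFunction.moebius e : ℂ) *
        ∑ n ∈ Finset.Ioc M (M + N) with (e : ℤ) ∣ n, χ.primitiveCharacter (n : ZMod d) := by
    simp_rw [Finset.sum_filter, Finset.mul_sum]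
    rw [Finset.sum_comm]
    refine Finset.sum_congr rfl fun n _ ↦ ?_
    rw [pv_char q χ r hr n, ← pv_moebius r hr0 n, Finset.sum_mul]
    refine Finset.sum_congr rfl fun e _ ↦ ?_
    split_ifs <;> simp
  have hlog2 := Real.log_two_gt_d9
  have hlq : Real.log 2 ≤ Real.log q := Real.log_le_log (by norm_num) (by exact_mod_cast hq)
  have hld : Real.log d ≤ Real.log q :=
    Real.log_le_log (by exact_mod_cast (by omega : 0 < d)) (by exact_mod_cast hdq)
  have hld0 : 0 ≤ Real.log d := Real.log_natCast_nonneg d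
  have hsq : Real.sqrt q = Real.sqrt d * Real.sqrt r := by
    rw [← Real.sqrt_mul (Nat.cast_nonneg _)]
    congr 1
    exact_mod_cast hr
  calc ‖∑ n ∈ Finset.Ioc M (M + N), χ (n : ZMod q)‖
      ≤ ∑ e ∈ r.divisors, Real.sqrt d * (1 + Real.log d) := by
        rw [hS]
        refine norm_sum_le_of_le _ fun e he ↦ ?_
        rw [norm_mul]
        refine (mul_le_of_le_one_left (norm_nonneg _) ?_).trans
          (pv_dvd d hd2 _ χ.primitiveCharacter_isPrimitive _ _ e (Nat.pos_of_mem_divisors he))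
        rw [Complex.norm_intCast]
        exact_mod_cast ArithmeticFunction.abs_moebius_le_one
    _ = r.divisors.card * (Real.sqrt d * (1 + Real.log d)) := by
        rw [Finset.sum_const, nsmul_eq_mul]
    _ ≤ (2 * Real.sqrt r) * (Real.sqrt d * (3 * Real.log q)) := by
        gcongr
        · exact pv_divisors r
        · linarith
    _ = 6 * Real.sqrt q * Real.log q := by rw [hsq]; ring
end

section
/- (Perron's formula) There is an absolute constant K such that for every positive real y ≠ 1 and all c, T > 0: | (1/(2πi)) ∫_{c-iT}^{c+iT} y^s / s ds − δ(y) | ≤ K y^c min{1, T^{-1} |log y|^{-1}}, where δ(y) = 1 if y > 1 and δ(y) = 0 if 0 < y < 1, and the integral is over the vertical segment s = c + it, −T ≤ t ≤ T. -/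
open Finset intervalIntegral

lemma pf_ne {a t : ℝ} (h : a ≠ 0 ∨ t ≠ 0) : (a : ℂ) + (t : ℂ) * Complex.I ≠ 0 := by
  intro h0
  have h1 := congrArg Complex.re h0
  have h2 := congrArg Complex.im h0
  simp at h1 h2
  tauto

lemma pf_cont {a : ℝ} (ha : a ≠ 0) (L : ℝ) : Continuous (fun t : ℝ =>
    Complex.exp (((a : ℂ) + (t : ℂ) * Complex.I) * (L : ℂ)) / ((a : ℂ) + (t : ℂ) * Complex.I)) := by
  apply Continuous.div (by fun_prop) (by fun_prop)
  intro t; exact pf_ne (Or.inl ha)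

lemma pf_cont' {η : ℝ} (h : η ≠ 0) (L : ℝ) : Continuous (fun x : ℝ =>
    Complex.exp (((x : ℂ) + (η : ℂ) * Complex.I) * (L : ℂ)) / ((x : ℂ) + (η : ℂ) * Complex.I)) := by
  apply Continuous.div (by fun_prop) (by fun_prop)
  intro t; exact pf_ne (Or.inr h)

lemma pf_icont {a : ℝ} (ha : a ≠ 0) : Continuous (fun t : ℝ =>
    1 / ((a : ℂ) + (t : ℂ) * Complex.I)) := by
  apply Continuous.div (by fun_prop) (by fun_prop)
  intro t; exact pf_ne (Or.inl ha)

lemma pf_icont' {η : ℝ} (h : η ≠ 0) : Continuous (fun x : ℝ =>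
    1 / ((x : ℂ) + (η : ℂ) * Complex.I)) := by
  apply Continuous.div (by fun_prop) (by fun_prop)
  intro t; exact pf_ne (Or.inr h)

lemma pf_arc {a : ℝ} (ha : a ≠ 0) (b : ℝ) :
    ∫ t in (-b)..b, 1 / ((a : ℂ) + (t : ℂ) * Complex.I) = ((2 * Real.arctan (b / a) : ℝ) : ℂ) := by
  have hd : ∀ t ∈ Set.uIcc (-b) b, HasDerivAt (fun t : ℝ => ((Real.arctan (t / a) : ℝ) : ℂ)
      - Complex.I / 2 * ((Real.log (a ^ 2 + t ^ 2) : ℝ) : ℂ))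
      (1 / ((a : ℂ) + (t : ℂ) * Complex.I)) t := by
    intro t _
    have hpos : 0 < a ^ 2 + t ^ 2 := by positivity
    have h1 : HasDerivAt (fun t : ℝ => Real.arctan (t / a)) (1 / (1 + (t / a) ^ 2) * (1 / a)) t :=
      ((hasDerivAt_id t).div_const a).arctan
    have h2 : HasDerivAt (fun t : ℝ => Real.log (a ^ 2 + t ^ 2)) ((2 * t) / (a ^ 2 + t ^ 2)) t := by
      have : HasDerivAt (fun t : ℝ => a ^ 2 + t ^ 2) (2 * t) t := by
        simpa using (hasDerivAt_pow 2 t).const_add (a ^ 2)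
      exact this.log hpos.ne'
    have h3 := h1.ofReal_comp.sub (h2.ofReal_comp.const_mul (Complex.I / 2))
    refine h3.congr_deriv ?_
    have e1 : 1 / (1 + (t / a) ^ 2) * (1 / a) = a / (a ^ 2 + t ^ 2) := by
      field_simp
    rw [e1]
    have hne := pf_ne (a := a) (t := t) (Or.inl ha)
    have hp : (a : ℂ) ^ 2 + (t : ℂ) ^ 2 ≠ 0 := by exact_mod_cast hpos.ne'
    push_cast
    field_simp
    linear_combination (-(t : ℂ) ^ 2) * Complex.I_sq
  rw [integral_eq_sub_of_hasDerivAt hd ((pf_icont ha).intervalIntegrable _ _)]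
  simp only [neg_sq, neg_div, Real.arctan_neg]
  push_cast
  ring

lemma pf_arc_sum {a b : ℝ} (ha : 0 < a) (hb : 0 < b) :
    Real.arctan (a / b) + Real.arctan (b / a) = Real.pi / 2 := by
  have := Real.arctan_inv_of_pos (div_pos ha hb)
  rw [inv_div] at this
  rw [this]; ring

lemma pf_norm (x η L : ℝ) : ‖Complex.exp (((x : ℂ) + (η : ℂ) * Complex.I) * (L : ℂ))‖
    = Real.exp (L * x) := by
  rw [Complex.norm_exp]; congr 1; simp; ring

lemma pf_hor {T L η a b : ℝ} (hT : 0 < T) (hL : L ≠ 0) (hη : |η| = T) (hab : a ≤ b) :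
    ‖∫ x in a..b, Complex.exp (((x : ℂ) + (η : ℂ) * Complex.I) * (L : ℂ)) /
      ((x : ℂ) + (η : ℂ) * Complex.I)‖ ≤ (Real.exp (L * b) - Real.exp (L * a)) / L / T := by
  have h := norm_integral_le_of_norm_le (μ := MeasureTheory.volume) (a := a) (b := b)
    (f := fun x : ℝ => Complex.exp (((x : ℂ) + (η : ℂ) * Complex.I) * (L : ℂ)) /
      ((x : ℂ) + (η : ℂ) * Complex.I)) (g := fun x => Real.exp (L * x) / T) hab ?_ ?_
  · refine h.trans (le_of_eq ?_)
    rw [intervalIntegral.integral_div, integral_comp_mul_left _ hL, integral_exp]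
    simp; ring
  · refine Filter.Eventually.of_forall fun x _ => ?_
    rw [norm_div, pf_norm]
    gcongr
    have := Complex.abs_im_le_norm ((x : ℂ) + (η : ℂ) * Complex.I)
    simp at this
    rwa [hη] at this
  · exact Continuous.intervalIntegrable (by fun_prop) _ _

lemma pf_neg {c T L : ℝ} (hc : 0 < c) (hT : 0 < T) (hL : L < 0) :
    ‖∫ t in (-T)..T, Complex.exp (((c : ℂ) + (t : ℂ) * Complex.I) * (L : ℂ)) /
      ((c : ℂ) + (t : ℂ) * Complex.I)‖ ≤ 2 * (Real.exp (L * c) / (|L| * T)) := by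
  have key : ∀ R, c < R → ‖∫ t in (-T)..T, Complex.exp (((c : ℂ) + (t : ℂ) * Complex.I) * (L : ℂ)) /
      ((c : ℂ) + (t : ℂ) * Complex.I)‖ ≤ 2 * (Real.exp (L * c) / (|L| * T)) + 2 * T / R := by
    intro R hR
    have hR0 : 0 < R := hc.trans hR
    have hrect := Complex.integral_boundary_rect_eq_zero_of_differentiableOn
      (fun s : ℂ => Complex.exp (s * L) / s) ((c : ℂ) + ((-T : ℝ) : ℂ) * Complex.I)
        ((R : ℂ) + (T : ℂ) * Complex.I) ?_
    · simp only [Complex.add_re, Complex.add_im, Complex.ofReal_re, Complex.ofReal_im,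
        Complex.mul_re, Complex.mul_im, Complex.I_re, Complex.I_im, mul_zero, mul_one, zero_mul,
        sub_zero, add_zero, zero_add, smul_eq_mul] at hrect
      have h1 := pf_hor (L := L) (η := -T) (a := c) (b := R) hT hL.ne (by rw [abs_neg, abs_of_pos hT]) hR.le
      have h2 := pf_hor (L := L) (η := T) (a := c) (b := R) hT hL.ne (abs_of_pos hT) hR.le
      have h3 : ‖∫ t in (-T)..T, Complex.exp (((R : ℂ) + (t : ℂ) * Complex.I) * (L : ℂ)) /
          ((R : ℂ) + (t : ℂ) * Complex.I)‖ ≤ (1 / R) * |T - (-T)| := by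
        apply norm_integral_le_of_norm_le_const
        intro t _
        rw [norm_div, pf_norm]
        have := Complex.abs_re_le_norm ((R : ℂ) + (t : ℂ) * Complex.I)
        simp [abs_of_pos hR0] at this
        have h4 : Real.exp (L * R) ≤ 1 := Real.exp_le_one_iff.2 (by nlinarith)
        gcongr
      have h5 : (Real.exp (L * R) - Real.exp (L * c)) / L / T ≤ Real.exp (L * c) / (|L| * T) := by
        rw [abs_of_neg hL, div_div, ← neg_div_neg_eq, ← neg_mul]
        have : 0 < -L := by linarith
        gcongr
        linarith [Real.exp_pos (L * R)]
      have h6 : (1 / R) * |T - (-T)| = 2 * T / R := by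
        rw [abs_of_pos (by linarith)]; ring
      rw [h6] at h3
      set A := ∫ x in c..R, Complex.exp (((x : ℂ) + ((-T : ℝ) : ℂ) * Complex.I) * (L : ℂ)) /
          ((x : ℂ) + ((-T : ℝ) : ℂ) * Complex.I)
      set B := ∫ x in c..R, Complex.exp (((x : ℂ) + (T : ℂ) * Complex.I) * (L : ℂ)) /
          ((x : ℂ) + (T : ℂ) * Complex.I)
      set F := ∫ t in (-T)..T, Complex.exp (((c : ℂ) + (t : ℂ) * Complex.I) * (L : ℂ)) /
          ((c : ℂ) + (t : ℂ) * Complex.I)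
      set G := ∫ t in (-T)..T, Complex.exp (((R : ℂ) + (t : ℂ) * Complex.I) * (L : ℂ)) /
          ((R : ℂ) + (t : ℂ) * Complex.I)
      have hF : Complex.I * F = A - B + Complex.I * G := by linear_combination -hrect
      have h7 : ‖F‖ = ‖A - B + Complex.I * G‖ := by rw [← hF]; simp
      rw [h7]
      have h8 := norm_add_le (A - B) (Complex.I * G)
      have h9 := norm_sub_le A B
      have h10 : ‖Complex.I * G‖ = ‖G‖ := by simp
      linarith
    · intro s hs
      have hs1 : s.re ∈ Set.uIcc c R := by
        have := hs.1
        simpa using this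
      rw [Set.uIcc_of_le hR.le] at hs1
      have : s ≠ 0 := by
        rintro rfl
        have := hs1.1
        simp at this
        linarith
      apply DifferentiableAt.differentiableWithinAt
      fun_prop (disch := assumption)
  have hlim : Filter.Tendsto (fun R : ℝ => 2 * (Real.exp (L * c) / (|L| * T)) + 2 * T / R)
      Filter.atTop (nhds (2 * (Real.exp (L * c) / (|L| * T)) + 0)) :=
    tendsto_const_nhds.add (tendsto_const_nhds.div_atTop Filter.tendsto_id)
  rw [add_zero] at hlim
  refine ge_of_tendsto hlim ?_
  filter_upwards [Filter.eventually_gt_atTop c] with R hR using key R hR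

lemma pf_pos {c T L : ℝ} (hc : 0 < c) (hT : 0 < T) (hL : 0 < L) :
    ‖(∫ t in (-T)..T, Complex.exp (((c : ℂ) + (t : ℂ) * Complex.I) * (L : ℂ)) /
      ((c : ℂ) + (t : ℂ) * Complex.I)) - ((2 * Real.pi : ℝ) : ℂ)‖
      ≤ 4 * (Real.exp (L * c) / (|L| * T)) := by
  have hrect := Complex.integral_boundary_rect_eq_zero_of_differentiableOn
      (dslope (fun s : ℂ => Complex.exp (s * L)) 0) (((-c : ℝ) : ℂ) + ((-T : ℝ) : ℂ) * Complex.I)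
        ((c : ℂ) + (T : ℂ) * Complex.I) (by
      have : DifferentiableOn ℂ (dslope (fun s : ℂ => Complex.exp (s * L)) 0) Set.univ := by
        rw [Complex.differentiableOn_dslope Filter.univ_mem]
        fun_prop
      exact this.mono (Set.subset_univ _))
  simp only [Complex.add_re, Complex.add_im, Complex.ofReal_re, Complex.ofReal_im,
        Complex.mul_re, Complex.mul_im, Complex.I_re, Complex.I_im, mul_zero, mul_one, zero_mul,
        sub_zero, add_zero, zero_add, smul_eq_mul] at hrect
  have hds : ∀ a t : ℝ, (a ≠ 0 ∨ t ≠ 0) → dslope (fun s : ℂ => Complex.exp (s * L)) 0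
      ((a : ℂ) + (t : ℂ) * Complex.I) = Complex.exp (((a : ℂ) + (t : ℂ) * Complex.I) * (L : ℂ)) /
      ((a : ℂ) + (t : ℂ) * Complex.I) - 1 / ((a : ℂ) + (t : ℂ) * Complex.I) := by
    intro a t h
    rw [dslope_of_ne _ (pf_ne h), slope_def_field]
    simp [sub_div]
  have hT' : -T ≠ 0 := by linarith
  have hc' : -c ≠ 0 := by linarith
  simp only [hds _ T (Or.inr hT.ne'), hds _ (-T) (Or.inr hT'), hds c _ (Or.inl hc.ne'),
    hds (-c) _ (Or.inl hc')] at hrect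
  rw [integral_sub ((pf_cont' hT' L).intervalIntegrable _ _) ((pf_icont' hT').intervalIntegrable _ _),
    integral_sub ((pf_cont' hT.ne' L).intervalIntegrable _ _) ((pf_icont' hT.ne').intervalIntegrable _ _),
    integral_sub ((pf_cont hc.ne' L).intervalIntegrable _ _) ((pf_icont hc.ne').intervalIntegrable _ _),
    integral_sub ((pf_cont hc' L).intervalIntegrable _ _) ((pf_icont hc').intervalIntegrable _ _),
    pf_arc hc.ne', pf_arc hc'] at hrect
  have hh : ∀ η : ℝ, η ≠ 0 → ∫ x in (-c)..c, 1 / ((x : ℂ) + (η : ℂ) * Complex.I)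
      = -Complex.I * ((2 * Real.arctan (c / η) : ℝ) : ℂ) := by
    intro η hη
    have e : ∀ x : ℝ, 1 / ((x : ℂ) + (η : ℂ) * Complex.I)
        = -Complex.I * (1 / ((η : ℂ) + ((-x : ℝ) : ℂ) * Complex.I)) := by
      intro x
      have h3 : (x : ℂ) + (η : ℂ) * Complex.I
          = Complex.I * ((η : ℂ) + ((-x : ℝ) : ℂ) * Complex.I) := by
        push_cast
        linear_combination (x : ℂ) * Complex.I_sq
      rw [h3, one_div, mul_inv, Complex.inv_I, one_div]
    simp only [e]
    rw [integral_const_mul, integral_comp_neg (fun x : ℝ => 1 / ((η : ℂ) + (x : ℂ) * Complex.I)),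
      neg_neg, pf_arc hη]
  rw [hh T hT.ne', hh (-T) hT'] at hrect
  have hrefl : (∫ t in (-T)..T, Complex.exp ((((-c : ℝ) : ℂ) + (t : ℂ) * Complex.I) * (L : ℂ)) /
      (((-c : ℝ) : ℂ) + (t : ℂ) * Complex.I)) = -∫ t in (-T)..T,
      Complex.exp (((c : ℂ) + (t : ℂ) * Complex.I) * ((-L : ℝ) : ℂ)) /
      ((c : ℂ) + (t : ℂ) * Complex.I) := by
    have := integral_comp_neg (a := -T) (b := T) (fun t : ℝ => 
      Complex.exp (((c : ℂ) + (t : ℂ) * Complex.I) * ((-L : ℝ) : ℂ)) /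
      ((c : ℂ) + (t : ℂ) * Complex.I))
    rw [neg_neg] at this
    rw [← this, ← intervalIntegral.integral_neg]
    congr 1
    ext t
    rw [← div_neg]
    congr 1
    · congr 1; push_cast; ring
    · push_cast; ring
  rw [hrefl] at hrect
  have hneg := pf_neg hc hT (L := -L) (by linarith)
  have h1 := pf_hor (L := L) (η := -T) (a := -c) (b := c) hT hL.ne' (by rw [abs_neg, abs_of_pos hT]) (by linarith)
  have h2 := pf_hor (L := L) (η := T) (a := -c) (b := c) hT hL.ne' (abs_of_pos hT) (by linarith)
  have h5 : (Real.exp (L * c) - Real.exp (L * -c)) / L / T ≤ Real.exp (L * c) / (|L| * T) - Real.exp (-L * c) / (|L| * T) := by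
    rw [abs_of_pos hL, ← sub_div, div_div, neg_mul, mul_neg]
  have h6 : Real.exp (-L * c) / (|L| * T) ≤ Real.exp (L * c) / (|L| * T) := by
    gcongr; linarith
  rw [abs_neg] at hneg
  have hs := pf_arc_sum hc hT
  set A := ∫ x in (-c)..c, Complex.exp (((x : ℂ) + ((-T : ℝ) : ℂ) * Complex.I) * (L : ℂ)) /
          ((x : ℂ) + ((-T : ℝ) : ℂ) * Complex.I)
  set B := ∫ x in (-c)..c, Complex.exp (((x : ℂ) + (T : ℂ) * Complex.I) * (L : ℂ)) /
          ((x : ℂ) + (T : ℂ) * Complex.I)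
  set F := ∫ t in (-T)..T, Complex.exp (((c : ℂ) + (t : ℂ) * Complex.I) * (L : ℂ)) /
          ((c : ℂ) + (t : ℂ) * Complex.I)
  set G := ∫ t in (-T)..T, Complex.exp (((c : ℂ) + (t : ℂ) * Complex.I) * ((-L : ℝ) : ℂ)) /
          ((c : ℂ) + (t : ℂ) * Complex.I)
  have hs' : ((Real.arctan (c / T) : ℝ) : ℂ) + ((Real.arctan (T / c) : ℝ) : ℂ) = (Real.pi : ℂ) / 2 := by
    rw [← Complex.ofReal_add, hs]; push_cast; rfl
  simp only [div_neg, Real.arctan_neg] at hrect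
  push_cast at hrect hs'
  have hF : Complex.I * (F - ((2 * Real.pi : ℝ) : ℂ)) = B - A - Complex.I * G := by
    push_cast
    linear_combination hrect + 4 * Complex.I * hs'
  have h7 : ‖F - ((2 * Real.pi : ℝ) : ℂ)‖ = ‖B - A - Complex.I * G‖ := by rw [← hF]; simp
  rw [h7]
  have h8 := norm_sub_le (B - A) (Complex.I * G)
  have h9 := norm_sub_le B A
  have h10 : ‖Complex.I * G‖ = ‖G‖ := by simp
  have h11 : 0 ≤ Real.exp (L * c) / (|L| * T) := by positivity
  linarith

lemma pf_small {c T L : ℝ} (hc : 0 < c) (hT : 0 < T) (h : T * |L| ≤ 1) :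
    ‖∫ t in (-T)..T, Complex.exp (((c : ℂ) + (t : ℂ) * Complex.I) * (L : ℂ)) /
      ((c : ℂ) + (t : ℂ) * Complex.I)‖ ≤ Real.exp (L * c) * (Real.pi + 2) := by
  have e : ∀ t : ℝ, Complex.exp (((c : ℂ) + (t : ℂ) * Complex.I) * (L : ℂ)) /
      ((c : ℂ) + (t : ℂ) * Complex.I) = Complex.exp ((L * c : ℝ) : ℂ) *
      ((Complex.exp (Complex.I * ((t * L : ℝ) : ℂ)) - 1) / ((c : ℂ) + (t : ℂ) * Complex.I)
        + 1 / ((c : ℂ) + (t : ℂ) * Complex.I)) := by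
    intro t
    rw [← add_div, sub_add_cancel, ← mul_div_assoc, ← Complex.exp_add]
    congr 2; push_cast; ring
  simp only [e]
  have hcont : Continuous (fun t : ℝ => (Complex.exp (Complex.I * ((t * L : ℝ) : ℂ)) - 1) /
      ((c : ℂ) + (t : ℂ) * Complex.I)) := by
    apply Continuous.div (by fun_prop) (by fun_prop)
    intro t; exact pf_ne (Or.inl hc.ne')
  rw [integral_const_mul, norm_mul, ← Complex.ofReal_exp, Complex.norm_real, Real.norm_eq_abs,
    abs_of_pos (Real.exp_pos _), integral_add (hcont.intervalIntegrable _ _)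
    ((pf_icont hc.ne').intervalIntegrable _ _), pf_arc hc.ne']
  gcongr
  refine (norm_add_le _ _).trans ?_
  have h1 : ‖∫ t in (-T)..T, (Complex.exp (Complex.I * ((t * L : ℝ) : ℂ)) - 1) /
      ((c : ℂ) + (t : ℂ) * Complex.I)‖ ≤ |L| * |T - (-T)| := by
    apply norm_integral_le_of_norm_le_const
    intro t _
    rw [norm_div, div_le_iff₀ (norm_pos_iff.2 (pf_ne (Or.inl hc.ne')))]
    refine (Real.norm_exp_I_mul_ofReal_sub_one_le).trans ?_
    rw [Real.norm_eq_abs, abs_mul, mul_comm]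
    gcongr
    have := Complex.abs_im_le_norm ((c : ℂ) + (t : ℂ) * Complex.I)
    simpa using this
  rw [abs_of_pos (by linarith : 0 < T - (-T))] at h1
  have h2 : ‖((2 * Real.arctan (T / c) : ℝ) : ℂ)‖ ≤ Real.pi := by
    rw [Complex.norm_real, Real.norm_eq_abs, abs_le]
    constructor <;> linarith [Real.arctan_lt_pi_div_two (T / c), Real.neg_pi_div_two_lt_arctan (T / c)]
  linarith

theorem stmt5 :
    ∃ K > 0, ∀ y c T : ℝ, 0 < y → y ≠ 1 → 0 < c → 0 < T →
      ‖((1 / (2 * Real.pi) : ℝ) : ℂ) *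
          (∫ t in (-T)..T,
            Complex.exp (((c : ℂ) + (t : ℂ) * Complex.I) * (Real.log y : ℂ)) /
              ((c : ℂ) + (t : ℂ) * Complex.I)) -
          (if 1 < y then 1 else 0)‖
        ≤ K * y ^ c * min 1 (T⁻¹ * |Real.log y|⁻¹) := by
  refine ⟨10, by norm_num, ?_⟩
  intro y c T hy hy1 hc hT
  have hL0 : Real.log y ≠ 0 := Real.log_ne_zero_of_pos_of_ne_one hy hy1
  rw [Real.rpow_def_of_pos hy]
  have hyL : 1 < y ↔ 0 < Real.log y := (Real.log_pos_iff hy.le).symm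
  simp only [hyL]
  generalize Real.log y = L at *
  have hpi := Real.pi_gt_three
  have hLa : 0 < |L| := abs_pos.2 hL0
  have hE := Real.exp_pos (L * c)
  set F := ∫ t in (-T)..T, Complex.exp (((c : ℂ) + (t : ℂ) * Complex.I) * (L : ℂ)) /
          ((c : ℂ) + (t : ℂ) * Complex.I) with hF
  have hpc : (Real.pi : ℂ) ≠ 0 := by exact_mod_cast Real.pi_ne_zero
  have hD : ((1 / (2 * Real.pi) : ℝ) : ℂ) * F - (if 0 < L then 1 else 0) =
      ((1 / (2 * Real.pi) : ℝ) : ℂ) * (F - ((if 0 < L then 2 * Real.pi else 0 : ℝ) : ℂ)) := by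
    split_ifs
    · push_cast; field_simp
    · simp
  rw [hD, norm_mul, Complex.norm_real, Real.norm_eq_abs, abs_of_pos (by positivity),
    one_div, inv_mul_le_iff₀ (by positivity)]
  have hm0 : 0 ≤ min 1 (T⁻¹ * |L|⁻¹) := by positivity
  rcases le_total (T * |L|) 1 with h | h
  · have h1 : 1 ≤ T⁻¹ * |L|⁻¹ := by
      rw [← mul_inv]; exact (one_le_inv₀ (by positivity)).2 h
    rw [min_eq_left h1]
    have h2 := pf_small hc hT h
    rw [← hF] at h2
    have h3 : ‖((if 0 < L then 2 * Real.pi else 0 : ℝ) : ℂ)‖ ≤ 2 * Real.pi * Real.exp (L * c) := by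
      rw [Complex.norm_real, Real.norm_eq_abs]
      split_ifs with hp
      · rw [abs_of_pos (by positivity)]
        have : 1 ≤ Real.exp (L * c) := Real.one_le_exp (by positivity)
        nlinarith
      · simp; positivity
    refine (norm_sub_le _ _).trans ((add_le_add h2 h3).trans ?_)
    nlinarith
  · have h1 : T⁻¹ * |L|⁻¹ ≤ 1 := by
      rw [← mul_inv]; exact inv_le_one_of_one_le₀ h
    rw [min_eq_right h1]
    have e : Real.exp (L * c) / (|L| * T) = Real.exp (L * c) * (T⁻¹ * |L|⁻¹) := by
      field_simp
    have hq : 0 < Real.exp (L * c) * (T⁻¹ * |L|⁻¹) := by positivity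
    have h4 : ‖F - ((if 0 < L then 2 * Real.pi else 0 : ℝ) : ℂ)‖ ≤
        4 * (Real.exp (L * c) / (|L| * T)) := by
      split_ifs with hp
      · exact pf_pos hc hT hp
      · have := pf_neg hc hT (lt_of_le_of_ne (not_lt.1 hp) hL0)
        rw [← hF] at this
        rw [e] at this ⊢
        simp only [Complex.ofReal_zero, sub_zero]
        linarith
    rw [e] at h4
    refine h4.trans ?_
    nlinarith
end

section
/- (Weyl's inequality) Let k ≥ 1, let f(x) = α x^k + a_{k-1} x^{k-1} + … + a_0 be a polynomial with real coefficients and leading coefficient α, and let N ≥ 1 be an integer. Then | Σ_{n ≤ N} e(f(n)) | ≤ 2 N { N^{-k} Σ_{-N < ℓ_1, …, ℓ_{k-1} < N} min( N, 1/‖ α k! ℓ_1 ℓ_2 ⋯ ℓ_{k-1} ‖ ) }^{2^{1-k}}, where the sum is over all (k−1)-tuples of integers ℓ_i with −N < ℓ_i < N, and min(N, 1/‖t‖) is interpreted as N when ‖t‖ = 0. -/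
open Finset
open scoped Classical

/-- `ee θ = e(θ) = exp(2πiθ)`. -/
noncomputable def ee (θ : ℝ) : ℂ := Complex.exp (2 * Real.pi * Complex.I * θ)

/-- `dnint x = ‖x‖` is the distance from `x` to the nearest integer. -/
noncomputable def dnint (x : ℝ) : ℝ := |x - round x|

noncomputable def FF (N : ℕ) (x : ℝ) : ℝ :=
  if dnint x = 0 then (N : ℝ) else min (N : ℝ) (dnint x)⁻¹

noncomputable def GG (N m : ℕ) (β : ℝ) : ℝ :=
  ∑ ℓ ∈ Fintype.piFinset (fun _ : Fin m => Finset.Ioo (-(N : ℤ)) (N : ℤ)), FF N (β * ∏ i, (ℓ i : ℝ))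

lemma FF_nonneg (N : ℕ) (x : ℝ) : 0 ≤ FF N x := by
  unfold FF dnint; split_ifs <;> positivity

lemma GG_nonneg (N m : ℕ) (x : ℝ) : 0 ≤ GG N m x :=
  Finset.sum_nonneg fun _ _ => FF_nonneg _ _

lemma GG_succ (N m : ℕ) (β : ℝ) :
    GG N (m + 1) β = ∑ h ∈ Finset.Ioo (-(N : ℤ)) (N : ℤ), GG N m (β * h) := by
  unfold GG
  rw [← Finset.sum_product']
  symm
  refine Finset.sum_nbij' (fun p : ℤ × (Fin m → ℤ) => (Fin.cons p.1 p.2 : Fin (m+1) → ℤ))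
    (fun ℓ => (ℓ 0, Fin.tail ℓ)) ?_ ?_ ?_ ?_ ?_
  · intro p hp
    rw [Finset.mem_product, Fintype.mem_piFinset] at hp
    rw [Fintype.mem_piFinset]
    intro i
    refine Fin.cases ?_ (fun j => ?_) i
    · simpa using hp.1
    · simpa using hp.2 j
  · intro ℓ hl
    rw [Fintype.mem_piFinset] at hl
    rw [Finset.mem_product, Fintype.mem_piFinset]
    exact ⟨hl 0, fun j => hl j.succ⟩
  · intro p _; simp
  · intro p _; simp
  · intro p _
    simp only [Fin.prod_univ_succ, Fin.cons_zero, Fin.cons_succ, mul_assoc]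

lemma ee_add (x y : ℝ) : ee (x + y) = ee x * ee y := by
  unfold ee; rw [← Complex.exp_add]; congr 1; push_cast; ring

lemma norm_ee (x : ℝ) : ‖ee x‖ = 1 := by
  unfold ee
  rw [show (2 * Real.pi * Complex.I * x : ℂ) = ((2 * Real.pi * x : ℝ) : ℂ) * Complex.I by push_cast; ring]
  exact Complex.norm_exp_ofReal_mul_I _

lemma conj_ee (x : ℝ) : (starRingEnd ℂ) (ee x) = ee (-x) := by
  unfold ee
  rw [← Complex.exp_conj]; congr 1; simp
  left; exact map_ofNat _ 2

lemma norm_ee_sub_one (x : ℝ) : 4 * dnint x ≤ ‖ee x - 1‖ := by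
  have h1 : ‖ee x - 1‖ = ‖2 * Real.sin (Real.pi * x)‖ := by
    unfold ee
    rw [show (2 * Real.pi * Complex.I * x : ℂ) = Complex.I * ((2 * Real.pi * x : ℝ) : ℂ) by push_cast; ring]
    rw [Complex.norm_exp_I_mul_ofReal_sub_one]
    congr 3; ring
  have h2 : |Real.sin (Real.pi * x)| = |Real.sin (Real.pi * (x - round x))| := by
    have : Real.pi * (x - round x) = Real.pi * x - (round x : ℤ) * Real.pi := by ring
    rw [this, Real.sin_sub_int_mul_pi, abs_mul]; simp
  have h3 := abs_sub_round x
  have h4 : |Real.sin (Real.pi * (x - round x))| = Real.sin (Real.pi * |x - round x|) := by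
    have hs : 0 ≤ Real.sin (Real.pi * |x - round x|) := by
      apply Real.sin_nonneg_of_nonneg_of_le_pi
      · positivity
      · nlinarith [Real.pi_pos]
    rcases abs_cases (x - round x) with ⟨h, _⟩ | ⟨h, _⟩
    · rw [h] at hs ⊢; exact abs_of_nonneg hs
    · rw [h, mul_neg, Real.sin_neg] at hs ⊢; exact abs_of_nonpos (by linarith)
  have h5 := Real.mul_le_sin (x := Real.pi * |x - round x|) (by positivity) (by nlinarith [Real.pi_pos])
  have h6 : 2 / Real.pi * (Real.pi * |x - round x|) = 2 * |x - round x| := by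
    field_simp
  rw [h1, norm_mul, Real.norm_eq_abs, Real.norm_eq_abs, h2, h4, abs_two]
  unfold dnint
  linarith

lemma geom (α β : ℝ) (a : ℤ) (j : ℕ) :
    (ee α - 1) * ∑ n ∈ Finset.Ico a (a + j), ee (α * n + β)
      = ee (α * ((a + j : ℤ) : ℝ) + β) - ee (α * a + β) := by
  induction j with
  | zero => simp
  | succ j ih =>
    have : Finset.Ico a (a + ((j+1 : ℕ) : ℤ)) = insert (a + (j:ℤ)) (Finset.Ico a (a + j)) := by
      ext x; simp only [Finset.mem_Ico, Finset.mem_insert]; push_cast; omega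
    rw [this, Finset.sum_insert (by simp), mul_add, ih]
    have h2 : ee (α * ((a + ((j+1 : ℕ):ℤ) : ℤ) : ℝ) + β) = ee α * ee (α * ((a + j : ℤ) : ℝ) + β) := by
      rw [← ee_add]; congr 1; push_cast; ring
    rw [h2]; ring

lemma base (N : ℕ) (α β : ℝ) (a b : ℤ) (hab : b - a ≤ N) :
    ‖∑ n ∈ Finset.Ico a b, ee (α * n + β)‖ ≤ FF N α := by
  have h1 : ‖∑ n ∈ Finset.Ico a b, ee (α * n + β)‖ ≤ N := by
    refine (norm_sum_le _ _).trans ?_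
    simp only [norm_ee, Finset.sum_const, Int.card_Ico, nsmul_eq_mul, mul_one]
    exact_mod_cast (by omega : (b - a).toNat ≤ N)
  unfold FF
  split_ifs with h
  · exact h1
  · refine le_min h1 ?_
    have hpos : 0 < dnint α := lt_of_le_of_ne (abs_nonneg _) (Ne.symm h)
    rcases le_or_gt b a with hba | hba
    · rw [Finset.Ico_eq_empty (by omega)]; simp [hpos.le]
    · obtain ⟨j, rfl⟩ : ∃ j : ℕ, b = a + j := ⟨(b - a).toNat, by omega⟩
      have hg := congrArg norm (geom α β a j)
      rw [norm_mul] at hg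
      have h2 := norm_sub_le (ee (α * ((a + j : ℤ) : ℝ) + β)) (ee (α * a + β))
      rw [norm_ee, norm_ee] at h2
      have h3 := norm_ee_sub_one α
      rw [← one_div, le_div_iff₀ hpos]
      nlinarith [norm_nonneg (∑ n ∈ Finset.Ico a (a + j), ee (α * n + β))]

lemma diff_sq (N : ℕ) (f : ℤ → ℝ) (a b : ℤ) (hab : b - a ≤ N) :
    ‖∑ n ∈ Finset.Ico a b, ee (f n)‖ ^ 2 ≤ ∑ h ∈ Finset.Ioo (-(N : ℤ)) (N : ℤ),
      ‖∑ n ∈ Finset.Ico (max a (a - h)) (min b (b - h)), ee (f (n + h) - f n)‖ := by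
  have key : (∑ n ∈ Finset.Ico a b, ee (f n)) * (starRingEnd ℂ) (∑ n ∈ Finset.Ico a b, ee (f n))
      = ∑ h ∈ Finset.Ioo (-(N : ℤ)) (N : ℤ),
        ∑ n ∈ Finset.Ico (max a (a - h)) (min b (b - h)), ee (f (n + h) - f n) := by
    rw [map_sum, Finset.sum_mul_sum, ← Finset.sum_product', Finset.sum_sigma']
    refine Finset.sum_nbij' (fun p : ℤ × ℤ => (⟨p.1 - p.2, p.2⟩ : (_ : ℤ) × ℤ))
      (fun q => (q.2 + q.1, q.2)) ?_ ?_ ?_ ?_ ?_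
    · rintro ⟨p, q⟩ hp
      simp only [Finset.mem_product, Finset.mem_Ico, Finset.mem_sigma, Finset.mem_Ioo] at hp ⊢
      omega
    · rintro ⟨p, q⟩ hp
      simp only [Finset.mem_product, Finset.mem_Ico, Finset.mem_sigma, Finset.mem_Ioo] at hp ⊢
      omega
    · rintro ⟨p, q⟩ _; simp
    · rintro ⟨p, q⟩ _; simp
    · rintro ⟨p, q⟩ _
      simp only [conj_ee, ← ee_add]
      congr 1
      rw [add_sub_cancel]; ring
  have h2 := congrArg norm key
  rw [norm_mul, RCLike.norm_conj, ← sq] at h2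
  rw [h2]
  exact norm_sum_le _ _

open Polynomial in
lemma poly_diff (m : ℕ) (p : ℝ[X]) (hp : p.natDegree ≤ m + 2) (h : ℝ) :
    (taylor h p - p).natDegree ≤ m + 1 ∧
    (taylor h p - p).coeff (m + 1) = (m + 2) * p.coeff (m + 2) * h := by
  constructor
  · rw [natDegree_le_iff_coeff_eq_zero]
    intro i hi
    rw [coeff_sub, taylor_coeff]
    have : (hasseDeriv i p).natDegree ≤ 0 := (natDegree_hasseDeriv_le p i).trans (by omega)
    rw [eval_eq_sum_range' (Nat.lt_succ_of_le this)]
    simp [hasseDeriv_coeff]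
  · rw [coeff_sub, taylor_coeff]
    have : (hasseDeriv (m+1) p).natDegree ≤ 1 := (natDegree_hasseDeriv_le p (m+1)).trans (by omega)
    rw [eval_eq_sum_range' (Nat.lt_succ_of_le this)]
    have h2 : (1 + (m + 1)).choose (m + 1) = m + 2 := by
      rw [show 1 + (m+1) = (m+1) + 1 by ring, Nat.choose_succ_self_right]
    simp [Finset.sum_range_succ, hasseDeriv_coeff, h2]
    rw [show 1 + (m+1) = m + 2 by ring]; simp

open Polynomial in
lemma weyl (N : ℕ) (hN : 1 ≤ N) (m : ℕ) : ∀ (p : ℝ[X]) (_ : p.natDegree ≤ m + 1) (a b : ℤ)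
    (_ : b - a ≤ N),
    ‖∑ n ∈ Finset.Ico a b, ee (p.eval (n : ℝ))‖ ^ (2 ^ m) * (2 * (N : ℝ)) ^ (m + 1)
      ≤ (2 * (N : ℝ)) ^ (2 ^ m) * GG N m (p.coeff (m + 1) * ((m + 1).factorial : ℝ)) := by
  induction m with
  | zero =>
    intro p hp a b hab
    have h1 : ∀ n : ℤ, p.eval (n : ℝ) = p.coeff 1 * n + p.coeff 0 := by
      intro n
      rw [eval_eq_sum_range' (Nat.lt_succ_of_le hp)]
      simp [Finset.sum_range_succ]; ring
    simp only [h1]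
    have := base N (p.coeff 1) (p.coeff 0) a b hab
    have h3 : GG N 0 (p.coeff (0 + 1) * ((0 + 1).factorial : ℝ)) = FF N (p.coeff 1) := by
      simp [GG]
    rw [h3]
    simp only [pow_zero, pow_one, zero_add]
    rw [mul_comm]
    gcongr
  | succ m ih =>
    intro p hp a b hab
    set S := ‖∑ n ∈ Finset.Ico a b, ee (p.eval (n : ℝ))‖ with hS
    set I := Finset.Ioo (-(N : ℤ)) (N : ℤ) with hI
    let T : ℤ → ℝ := fun h => ‖∑ n ∈ Finset.Ico (max a (a - h)) (min b (b - h)),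
      ee (p.eval ((n + h : ℤ) : ℝ) - p.eval (n : ℝ))‖
    have hT0 : ∀ h, 0 ≤ T h := fun h => norm_nonneg _
    have hd : S ^ 2 ≤ ∑ h ∈ I, T h := diff_sq N (fun n => p.eval (n : ℝ)) a b hab
    have hT : ∀ h ∈ I, T h ^ (2 ^ m) * (2 * (N : ℝ)) ^ (m + 1) ≤ (2 * (N : ℝ)) ^ (2 ^ m) *
        GG N m (p.coeff (m + 1 + 1) * ((m + 1 + 1).factorial : ℝ) * h) := by
      intro h _
      obtain ⟨d1, d2⟩ := poly_diff m p hp h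
      have := ih (taylor (h : ℝ) p - p) d1 (max a (a - h)) (min b (b - h)) (by omega)
      rw [d2] at this
      have e1 : ((m : ℝ) + 2) * p.coeff (m + 2) * h * ((m + 1).factorial : ℝ)
          = p.coeff (m + 1 + 1) * ((m + 1 + 1).factorial : ℝ) * h := by
        rw [Nat.factorial_succ (m + 1)]; push_cast; ring
      rw [e1] at this
      convert this using 6
      rw [eval_sub, taylor_eval]; push_cast; rfl
    have hcard : (I.card : ℝ) ≤ 2 * N := by
      rw [hI, Int.card_Ioo]; exact_mod_cast (by omega : ((N : ℤ) - -N - 1).toNat ≤ 2 * N)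
    obtain ⟨q, hq⟩ : ∃ q, 2 ^ m = q + 1 := ⟨2 ^ m - 1, by have := Nat.one_le_two_pow (n := m); omega⟩
    have hJ : (∑ h ∈ I, T h) ^ (2 ^ m) ≤ (2 * (N : ℝ)) ^ q * ∑ h ∈ I, T h ^ (2 ^ m) := by
      rw [hq]
      refine (pow_sum_le_card_mul_sum_pow (s := I) (f := T) (fun h _ => hT0 h) q).trans ?_
      have : 0 ≤ ∑ h ∈ I, T h ^ (q + 1) := Finset.sum_nonneg fun h _ => pow_nonneg (hT0 h) _
      exact mul_le_mul_of_nonneg_right (pow_le_pow_left₀ (Nat.cast_nonneg _) hcard q) this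
    rw [GG_succ, Finset.mul_sum]
    calc S ^ 2 ^ (m + 1) * (2 * (N : ℝ)) ^ (m + 1 + 1)
        = (S ^ 2) ^ (2 ^ m) * (2 * (N : ℝ)) ^ (m + 1 + 1) := by rw [← pow_mul, pow_succ' 2 m]
      _ ≤ (∑ h ∈ I, T h) ^ (2 ^ m) * (2 * (N : ℝ)) ^ (m + 1 + 1) := by gcongr
      _ ≤ ((2 * (N : ℝ)) ^ q * ∑ h ∈ I, T h ^ (2 ^ m)) * (2 * (N : ℝ)) ^ (m + 1 + 1) := by gcongr
      _ = (2 * (N : ℝ)) ^ (q + 1) * ∑ h ∈ I, T h ^ (2 ^ m) * (2 * (N : ℝ)) ^ (m + 1) := by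
        rw [← Finset.sum_mul]; ring
      _ ≤ (2 * (N : ℝ)) ^ (q + 1) * ∑ h ∈ I, (2 * (N : ℝ)) ^ (2 ^ m) *
          GG N m (p.coeff (m + 1 + 1) * ((m + 1 + 1).factorial : ℝ) * h) := by
        exact mul_le_mul_of_nonneg_left (Finset.sum_le_sum hT) (by positivity)
      _ = _ := by
        rw [Finset.mul_sum]
        refine Finset.sum_congr rfl fun h _ => ?_
        rw [← mul_assoc, ← hq, ← pow_add, ← two_mul, ← pow_succ']

theorem stmt6 (k : ℕ) (hk : 1 ≤ k) (α : ℝ) (a : ℕ → ℝ) (N : ℕ) (hN : 1 ≤ N) :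
    ‖∑ n ∈ Finset.Icc 1 N,
        ee (α * (n : ℝ) ^ k + ∑ j ∈ Finset.range k, a j * (n : ℝ) ^ j)‖
      ≤ 2 * (N : ℝ) *
        ((N : ℝ) ^ (-(k : ℝ)) *
          ∑ ℓ ∈ Fintype.piFinset (fun _ : Fin (k - 1) => Finset.Ioo (-(N : ℤ)) (N : ℤ)),
            (if dnint (α * (Nat.factorial k : ℝ) * ∏ i, (ℓ i : ℝ)) = 0 then (N : ℝ)
             else min (N : ℝ) (dnint (α * (Nat.factorial k : ℝ) * ∏ i, (ℓ i : ℝ)))⁻¹))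
          ^ ((2 : ℝ) ^ (1 - (k : ℝ))) := by
  obtain ⟨m, rfl⟩ : ∃ m, k = m + 1 := ⟨k - 1, by omega⟩
  change _ ≤ 2 * (N : ℝ) * ((N : ℝ) ^ (-((m + 1 : ℕ) : ℝ)) *
    GG N m (α * (Nat.factorial (m + 1) : ℝ))) ^ ((2 : ℝ) ^ (1 - ((m + 1 : ℕ) : ℝ)))
  let p : Polynomial ℝ := Polynomial.C α * Polynomial.X ^ (m + 1)
    + ∑ j ∈ Finset.range (m + 1), Polynomial.C (a j) * Polynomial.X ^ j
  have hp1 : p.natDegree ≤ m + 1 := by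
    refine Polynomial.natDegree_add_le_of_degree_le (Polynomial.natDegree_C_mul_X_pow_le _ _) ?_
    refine Polynomial.natDegree_sum_le_of_forall_le _ _ fun j hj => ?_
    refine (Polynomial.natDegree_C_mul_X_pow_le _ _).trans ?_
    rw [Finset.mem_range] at hj; omega
  have hp2 : p.coeff (m + 1) = α := by
    simp only [p, Polynomial.coeff_add, Polynomial.finsetSum_coeff, Polynomial.coeff_C_mul_X_pow]
    rw [Finset.sum_eq_zero]
    · simp
    · intro j hj
      rw [Finset.mem_range] at hj
      rw [if_neg (by omega)]
  have hS : ∑ n ∈ Finset.Icc 1 N, ee (α * (n : ℝ) ^ (m + 1) + ∑ j ∈ Finset.range (m + 1), a j * (n : ℝ) ^ j)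
      = ∑ n ∈ Finset.Ico (1 : ℤ) (N + 1), ee (p.eval (n : ℝ)) := by
    refine Finset.sum_nbij' (fun n : ℕ => (n : ℤ)) (fun n : ℤ => n.toNat) ?_ ?_ ?_ ?_ ?_
    · intro n hn; rw [Finset.mem_Icc] at hn; rw [Finset.mem_Ico]; omega
    · intro n hn; rw [Finset.mem_Ico] at hn; rw [Finset.mem_Icc]; omega
    · intro n hn; simp
    · intro n hn; rw [Finset.mem_Ico] at hn; omega
    · intro n hn
      simp [p, Polynomial.eval_finsetSum]
  rw [hS]
  have hw := weyl N hN m p hp1 1 (N + 1) (by omega)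
  rw [hp2] at hw
  set S := ‖∑ n ∈ Finset.Ico (1 : ℤ) (N + 1), ee (p.eval (n : ℝ))‖
  have hS0 : 0 ≤ S := norm_nonneg _
  have hG := GG_nonneg N m (α * (Nat.factorial (m + 1) : ℝ))
  set G := GG N m (α * (Nat.factorial (m + 1) : ℝ))
  have hN0 : (0 : ℝ) < N := by exact_mod_cast hN
  have hX : (S / (2 * N)) ^ (2 ^ m) ≤ (N : ℝ) ^ (-((m + 1 : ℕ) : ℝ)) * G := by
    rw [Real.rpow_neg hN0.le, Real.rpow_natCast, div_pow, div_le_iff₀ (by positivity)]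
    rw [inv_mul_eq_div, div_mul_eq_mul_div, le_div_iff₀ (by positivity)]
    calc S ^ 2 ^ m * (N : ℝ) ^ (m + 1) ≤ S ^ 2 ^ m * (2 * (N : ℝ)) ^ (m + 1) := by
          gcongr; linarith
      _ ≤ _ := by rw [mul_comm G]; exact hw
  have hexp : (2 : ℝ) ^ (1 - ((m + 1 : ℕ) : ℝ)) = (((2 ^ m : ℕ) : ℝ))⁻¹ := by
    push_cast
    rw [show (1 : ℝ) - (m + 1) = -(m : ℝ) by ring, Real.rpow_neg (by norm_num), Real.rpow_natCast]
  have hY : S / (2 * N) ≤ ((N : ℝ) ^ (-((m + 1 : ℕ) : ℝ)) * G) ^ ((2 : ℝ) ^ (1 - ((m + 1 : ℕ) : ℝ))) := by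
    rw [hexp, ← Real.pow_rpow_inv_natCast (x := S / (2 * N)) (n := 2 ^ m) (by positivity) (by positivity)]
    exact Real.rpow_le_rpow (by positivity) hX (by positivity)
  rw [div_le_iff₀ (by positivity)] at hY
  linarith
end

section
/- For every ε > 0 there is a constant C(ε) such that for all y ≥ 2 and all 1 ≤ Q_1 < U: Σ_{k ≤ y} | Σ_{Q_1 < q ≤ U} (μ(q)/φ(q)) ∏_{p | q} (n_{k,p} − 1) |^2 ≤ C(ε) ( y Q_1^{-(1-ε)} + U^{1+ε} ), where the inner sum runs over squarefree integers q in (Q_1, U] all of whose prime factors are congruent to 1 modulo 4. -/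
open Finset
open scoped Classical

/-- `nSol k r p` is the number of solutions `n ∈ ℤ/pℤ` of `n^r + k ≡ 0 (mod p)`. -/
def nSol (k : ℤ) (r p : ℕ) : ℕ :=
  (Finset.filter (fun n : ℕ => ((n : ℤ) ^ r + k) % (p : ℤ) = 0) (Finset.range p)).card


lemma pow_omega_bound (A : ℝ) (hA : 1 ≤ A) (δ : ℝ) (hδ : 0 < δ) :
    ∃ C : ℝ, 1 ≤ C ∧ ∀ n : ℕ, n ≠ 0 → A ^ (n.primeFactors.card) ≤ C * (n : ℝ) ^ δ := by
  obtain ⟨K, hK⟩ := exists_nat_ge (A ^ (1 / δ))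
  refine ⟨A ^ K, one_le_pow₀ hA, fun n hn => ?_⟩
  have h1 : A ^ (n.primeFactors.card) =
      (∏ p ∈ n.primeFactors with p ≤ K, A) * ∏ p ∈ n.primeFactors with ¬ p ≤ K, A := by
    rw [Finset.prod_filter_mul_prod_filter_not, Finset.prod_const]
  rw [h1]
  have hA0 : (0:ℝ) ≤ A := by linarith
  have h2 : (∏ p ∈ n.primeFactors with p ≤ K, A) ≤ A ^ K := by
    rw [Finset.prod_const]
    apply pow_le_pow_right₀ hA
    calc _ ≤ (Finset.Icc 1 K).card := by
          apply Finset.card_le_card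
          intro p hp
          simp only [Finset.mem_filter] at hp
          simp [hp.2, (Nat.prime_of_mem_primeFactors hp.1).one_le]
      _ = K := by simp
  have h3 : (∏ p ∈ n.primeFactors with ¬ p ≤ K, A) ≤ ∏ p ∈ n.primeFactors with ¬ p ≤ K, (p:ℝ)^δ := by
    apply Finset.prod_le_prod
    · intros; exact hA0
    · intro p hp
      simp only [Finset.mem_filter, not_le] at hp
      have : A ^ (1/δ) ≤ p := hK.trans (by exact_mod_cast hp.2.le)
      calc A = (A ^ (1/δ)) ^ δ := by rw [← Real.rpow_mul hA0]; field_simp; simp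
        _ ≤ _ := by gcongr
  have h4 : ∏ p ∈ n.primeFactors with ¬ p ≤ K, (p:ℝ)^δ ≤ (n:ℝ)^δ := by
    rw [Real.finsetProd_rpow _ _ (by intros; positivity)]
    apply Real.rpow_le_rpow (by positivity) _ hδ.le
    rw [← Nat.cast_prod]
    have : ∏ p ∈ n.primeFactors with ¬ p ≤ K, p ∣ n :=
      (Finset.prod_dvd_prod_of_subset _ _ _ (Finset.filter_subset _ _)).trans (Nat.prod_primeFactors_dvd n)
    exact_mod_cast Nat.le_of_dvd (Nat.pos_of_ne_zero hn) this
  have h5 : 0 ≤ ∏ p ∈ n.primeFactors with ¬ p ≤ K, A := Finset.prod_nonneg (by intros; exact hA0)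
  gcongr
  exact h3.trans h4

/-- Fourier bound predicate. -/
def FB (L : ℕ) [NeZero L] (F : ℤ → ℂ) (B Z : ℝ) : Prop :=
  ∃ G : ZMod L → ℂ, (∀ k : ℤ, F k = G k) ∧ (∀ ψ : AddChar (ZMod L) ℂ, ‖∑ x, G x * ψ x‖ ≤ B) ∧
    ‖∑ x, G x‖ ≤ Z

lemma FB_mul {m n : ℕ} [NeZero m] [NeZero n] [NeZero (m*n)] (h : m.Coprime n) {F₁ F₂ : ℤ → ℂ} {B₁ B₂ Z₁ Z₂ : ℝ}
    (h1 : FB m F₁ B₁ Z₁) (h2 : FB n F₂ B₂ Z₂) : FB (m*n) (fun k => F₁ k * F₂ k) (B₁*B₂) (Z₁*Z₂) := by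
  obtain ⟨G₁, e1, b1, z1⟩ := h1
  obtain ⟨G₂, e2, b2, z2⟩ := h2
  let e := ZMod.chineseRemainder h
  refine ⟨fun x => G₁ (e x).1 * G₂ (e x).2, fun k => ?_, fun ψ => ?_, ?_⟩
  · simp [e1, e2]
  · have : ∑ x, G₁ (e x).1 * G₂ (e x).2 * ψ x = (∑ x, G₁ x * (ψ.compAddMonoidHom (e.symm.toAddMonoidHom.comp (AddMonoidHom.inl _ _))) x) * ∑ x, G₂ x * (ψ.compAddMonoidHom (e.symm.toAddMonoidHom.comp (AddMonoidHom.inr _ _))) x := by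
      rw [← Equiv.sum_comp e.symm.toEquiv, Fintype.sum_prod_type, Finset.sum_mul_sum]
      refine Finset.sum_congr rfl fun x _ => Finset.sum_congr rfl fun y _ => ?_
      have : ((x,y) : ZMod m × ZMod n) = (x,0) + (0,y) := by simp
      have h3 : ψ (e.symm (x,y)) = ψ (e.symm (x,0)) * ψ (e.symm (0,y)) := by
        rw [this, map_add, AddChar.map_add_eq_mul]
      simp [h3]
      ring
    rw [this, norm_mul]
    exact mul_le_mul (b1 _) (b2 _) (norm_nonneg _) ((norm_nonneg _).trans (b1 1))
  · have : ∑ x, G₁ (e x).1 * G₂ (e x).2 = (∑ x, G₁ x) * ∑ x, G₂ x := by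
      rw [← Equiv.sum_comp e.symm.toEquiv, Fintype.sum_prod_type, Finset.sum_mul_sum]
      simp
    rw [this, norm_mul]
    exact mul_le_mul z1 z2 (norm_nonneg _) ((norm_nonneg _).trans z1)

lemma FB_prod (P : Finset ℕ) (hP : ∀ p ∈ P, p.Prime) (F : ℕ → ℤ → ℂ) (B Z : ℕ → ℝ)
    (h : ∀ p (hp : p.Prime), p ∈ P → haveI : NeZero p := ⟨hp.ne_zero⟩; FB p (F p) (B p) (Z p))
    (L : ℕ) [hn : NeZero L] (hL : L = ∏ p ∈ P, p) :
    FB L (fun k => ∏ p ∈ P, F p k) (∏ p ∈ P, B p) (∏ p ∈ P, Z p) := by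
  induction P using Finset.induction_on generalizing L with
  | empty =>
    obtain rfl : L = 1 := by simpa using hL
    refine ⟨fun _ => 1, fun k => by simp, fun ψ => ?_, ?_⟩
    · have : ∀ x : ZMod 1, ψ x = 1 := by
        intro x
        have : x = 0 := Subsingleton.elim _ _
        simp [this]
      simp
    · simp
  | insert a s ha ih =>
    have hs : NeZero (∏ p ∈ s, p) := ⟨Finset.prod_ne_zero_iff.2 fun p hp => (hP p (by simp [hp])).ne_zero⟩
    have hap : a.Prime := hP a (by simp)
    have : NeZero a := ⟨hap.ne_zero⟩
    have ih' := ih (fun p hp => hP p (by simp [hp])) (fun p hp hps => h p hp (by simp [hps])) _ rfl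
    have hc : Nat.Coprime a (∏ p ∈ s, p) := by
      apply Nat.Coprime.prod_right
      intro p hp
      rw [Nat.coprime_primes hap (hP p (by simp [hp]))]
      rintro rfl; exact ha hp
    rw [Finset.prod_insert ha] at hL
    subst hL
    have := FB_mul hc (h a hap (by simp)) ih'
    simp only [Finset.prod_insert ha]
    exact this

lemma norm_std_sub_one (L : ℕ) [NeZero L] (j : ZMod L) :
    ‖(ZMod.stdAddChar j : ℂ) - 1‖ = 2 * Real.sin (Real.pi * j.val / L) := by
  have hL : (0:ℝ) < L := by exact_mod_cast NeZero.pos L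
  have h1 : (ZMod.stdAddChar j : ℂ) = Complex.exp (Complex.I * ((2 * Real.pi * j.val / L : ℝ) : ℂ)) := by
    have := ZMod.stdAddChar_coe (N := L) (j.val : ℤ)
    rw [Int.cast_natCast, ZMod.natCast_zmod_val] at this
    rw [this]
    congr 1
    push_cast
    ring
  rw [h1, Complex.norm_exp_I_mul_ofReal_sub_one, Real.norm_eq_abs, abs_of_nonneg]
  · congr 2; ring
  · have h2 : 0 ≤ Real.sin (2 * Real.pi * j.val / L / 2) := by
      apply Real.sin_nonneg_of_nonneg_of_le_pi
      · positivity
      · have : (j.val : ℝ) ≤ L := by exact_mod_cast (ZMod.val_lt j).le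
        rw [div_div, div_le_iff₀ (by positivity)]
        nlinarith [Real.pi_pos]
    linarith

lemma geom_bound (L : ℕ) [NeZero L] (j : ZMod L) (hj : j ≠ 0) (N : ℕ) :
    ‖∑ k ∈ Finset.Icc 1 N, (ZMod.stdAddChar (j * (k : ZMod L)) : ℂ)‖ ≤
      L / 2 * (1 / (j.val : ℝ) + 1 / ((L : ℝ) - j.val)) := by
  have hL : (0:ℝ) < L := by exact_mod_cast NeZero.pos L
  set z : ℂ := ZMod.stdAddChar j with hz
  have hz1 : ‖z‖ = 1 := AddChar.norm_apply _ _
  have hv : (0:ℝ) < j.val := by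
    have : j.val ≠ 0 := by rwa [Ne, ZMod.val_eq_zero]
    exact_mod_cast Nat.pos_of_ne_zero this
  have hvL : (j.val : ℝ) < L := by exact_mod_cast ZMod.val_lt j
  have hsin : 4 / L / (1 / (j.val : ℝ) + 1 / ((L : ℝ) - j.val)) ≤ ‖z - 1‖ := by
    rw [norm_std_sub_one]
    set v : ℝ := (j.val : ℝ)
    have hw : 0 < (L:ℝ) - v := by linarith
    have hmin : ∀ w : ℝ, 0 < w → w ≤ L / 2 → 4 / L * w ≤ 2 * Real.sin (Real.pi * w / L) := by
      intro w hw0 hw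
      have := Real.mul_le_sin (x := Real.pi * w / L) (by positivity) (by
        rw [div_le_div_iff₀ hL (by norm_num)]; nlinarith [Real.pi_pos])
      have h2 : 2 / Real.pi * (Real.pi * w / L) = 2 / L * w := by field_simp
      rw [h2] at this
      have h3 : 4 / L * w = 2 * (2 / L * w) := by ring
      linarith
    rcases le_total v (L / 2) with h | h
    · refine le_trans ?_ (hmin v hv h)
      rw [div_le_iff₀ (by positivity)]
      have : 4 / L * v * (1/v + 1/(L - v)) = 4 / L + 4/L * v * (1 / (L - v)) := by field_simp
      rw [this]
      have : 0 ≤ 4/L * v * (1 / (L - v)) := by positivity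
      linarith
    · have h4 := hmin (L - v) hw (by linarith)
      have h5 : Real.sin (Real.pi * (L - v) / L) = Real.sin (Real.pi * v / L) := by
        rw [← Real.sin_pi_sub]; congr 1; field_simp; ring
      rw [h5] at h4
      refine le_trans ?_ h4
      rw [div_le_iff₀ (by positivity)]
      have : 4 / L * (L - v) * (1/v + 1/(L - v)) = 4 / L + 4/L * (L - v) * (1 / v) := by field_simp; ring
      rw [this]
      have : 0 ≤ 4/L * (L - v) * (1 / v) := by positivity
      linarith
  have hw : 0 < (L:ℝ) - j.val := by linarith
  have hpos : 0 < ‖z - 1‖ := lt_of_lt_of_le (by positivity) hsin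
  have hne : z ≠ 1 := by
    intro h; rw [h] at hpos; simp at hpos
  have hsum : ∑ k ∈ Finset.Icc 1 N, (ZMod.stdAddChar (j * (k : ZMod L)) : ℂ) = z * ((z ^ N - 1) / (z - 1)) := by
    rw [← geom_sum_eq hne, Finset.mul_sum, ← Finset.Ico_add_one_right_eq_Icc, Finset.sum_Ico_eq_sum_range]
    refine Finset.sum_congr (by simp) fun k _ => ?_
    rw [mul_comm, ← nsmul_eq_mul, AddChar.map_nsmul_eq_pow, ← hz, add_comm, pow_succ']
  rw [hsum, norm_mul, norm_div, hz1, one_mul, div_le_iff₀ hpos]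
  have h6 : ‖z ^ N - 1‖ ≤ 2 := by
    refine (norm_sub_le _ _).trans ?_
    rw [norm_pow, hz1]; norm_num
  refine h6.trans ?_
  rw [div_le_iff₀ (by positivity), div_le_iff₀ hL] at hsin
  nlinarith

lemma sum_recip (L : ℕ) [NeZero L] :
    ∑ j : ZMod L, (1 / (j.val : ℝ) + 1 / ((L : ℝ) - j.val)) ≤ 2 * (1 + Real.log L) := by
  obtain ⟨n, rfl⟩ : ∃ n, L = n + 1 := ⟨L - 1, by have := NeZero.pos L; omega⟩
  have h0 : ∑ j : ZMod (n+1), (1 / (j.val : ℝ) + 1 / (((n+1:ℕ) : ℝ) - j.val))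
      = ∑ i ∈ Finset.range (n+1), (1 / (i : ℝ) + 1 / (((n+1:ℕ) : ℝ) - i)) := by
    rw [Finset.sum_range]; rfl
  rw [h0, Finset.sum_add_distrib]
  have hh := harmonic_le_one_add_log (n+1)
  have hH : ((harmonic (n+1) : ℚ) : ℝ) = ∑ i ∈ Finset.range (n+1), 1 / ((i:ℝ)+1) := by
    simp [harmonic]
  have h1 : ∑ i ∈ Finset.range (n+1), 1 / (((n+1:ℕ) : ℝ) - i) = ∑ i ∈ Finset.range (n+1), 1 / ((i:ℝ)+1) := by
    rw [← Finset.sum_range_reflect]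
    refine Finset.sum_congr rfl fun i hi => ?_
    have : i ≤ n := by simp at hi; omega
    rw [show n + 1 - 1 - i = n - i by omega, Nat.cast_sub this]
    push_cast; congr 1; ring
  have h2 : ∑ i ∈ Finset.range (n+1), 1 / (i : ℝ) ≤ ∑ i ∈ Finset.range (n+1), 1 / ((i:ℝ)+1) := by
    rw [Finset.sum_range_succ', Finset.sum_range_succ _ n]
    simp only [Nat.cast_add, Nat.cast_one, Nat.cast_zero, div_zero, add_zero]
    have : 0 ≤ 1 / ((n:ℝ)+1) := by positivity
    linarith
  rw [hH] at hh
  linarith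

lemma FB_incomplete (L : ℕ) [NeZero L] {F : ℤ → ℂ} {B : ℝ} (h : FB L F B 0) (N : ℕ) :
    ‖∑ k ∈ Finset.Icc 1 N, F k‖ ≤ B * (1 + Real.log L) := by
  obtain ⟨G, e, b, z⟩ := h
  have hL : (0:ℝ) < L := by exact_mod_cast NeZero.pos L
  have hB : 0 ≤ B := (norm_nonneg _).trans (b 1)
  have key : ∀ k : ℕ, F k = (L : ℂ)⁻¹ * ∑ j, ZMod.stdAddChar (j * (k : ZMod L)) * ZMod.dft G j := by
    intro k
    have := ZMod.invDFT_apply (ZMod.dft G) (k : ZMod L)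
    rw [LinearEquiv.symm_apply_apply] at this
    rw [e, Int.cast_natCast, this]
    simp
  have hd : ∀ j, ‖ZMod.dft G j‖ ≤ B := by
    intro j
    refine le_trans (le_of_eq ?_) (b (AddChar.mulShift ZMod.stdAddChar (-j)))
    rw [ZMod.dft_apply]
    congr 1
    refine Finset.sum_congr rfl fun x _ => ?_
    rw [AddChar.mulShift_apply, smul_eq_mul, mul_comm]
    congr 2; ring
  have hd0 : ZMod.dft G 0 = 0 := by
    rw [ZMod.dft_apply]
    simpa using z
  have : ∑ k ∈ Finset.Icc 1 N, F k = (L : ℂ)⁻¹ * ∑ j, ZMod.dft G j * ∑ k ∈ Finset.Icc 1 N, ZMod.stdAddChar (j * (k : ZMod L)) := by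
    simp_rw [key]
    rw [← Finset.mul_sum, Finset.sum_comm]
    congr 1
    refine Finset.sum_congr rfl fun x _ => ?_
    rw [← Finset.sum_mul, mul_comm]
  rw [this, norm_mul, norm_inv, Complex.norm_natCast]
  calc (L:ℝ)⁻¹ * ‖∑ j, ZMod.dft G j * ∑ k ∈ Finset.Icc 1 N, ZMod.stdAddChar (j * (k : ZMod L))‖
      ≤ (L:ℝ)⁻¹ * ∑ j : ZMod L, B * (L / 2 * (1 / (j.val : ℝ) + 1 / ((L : ℝ) - j.val))) := by
        gcongr
        refine (norm_sum_le _ _).trans (Finset.sum_le_sum fun j _ => ?_)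
        rw [norm_mul]
        by_cases hj : j = 0
        · subst hj
          rw [hd0]; simp; positivity
        · exact mul_le_mul (hd j) (geom_bound L j hj N) (norm_nonneg _) hB
    _ = B / 2 * ∑ j : ZMod L, (1 / (j.val : ℝ) + 1 / ((L : ℝ) - j.val)) := by
        rw [Finset.mul_sum, Finset.mul_sum]
        refine Finset.sum_congr rfl fun x _ => ?_
        field_simp
    _ ≤ B / 2 * (2 * (1 + Real.log L)) := by gcongr; exact sum_recip L
    _ = _ := by ring

lemma card_pow4 (p : ℕ) [Fact p.Prime] (c : ZMod p) :
    (Finset.univ.filter (fun n : ZMod p => n ^ 4 = c)).card ≤ 4 := by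
  calc _ ≤ (Polynomial.nthRoots 4 c).toFinset.card := by
        apply Finset.card_le_card
        intro n hn
        simp only [Finset.mem_filter, Finset.mem_univ, true_and] at hn
        simp [Polynomial.mem_nthRoots, hn]
    _ ≤ (Polynomial.nthRoots 4 c).card := Multiset.toFinset_card_le _
    _ ≤ 4 := Polynomial.card_nthRoots 4 c

lemma second_moment (p : ℕ) [Fact p.Prime] (ψ : AddChar (ZMod p) ℂ) (hψ : ψ ≠ 1) :
    ∑ a : ZMod p, ‖∑ n : ZMod p, ψ (a * n ^ 4)‖ ^ 2 ≤ 4 * (p : ℝ) ^ 2 := by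
  have hprim := AddChar.IsPrimitive.of_ne_one hψ
  have h1 : ((∑ a : ZMod p, ‖∑ n : ZMod p, ψ (a * n ^ 4)‖ ^ 2 : ℝ) : ℂ) =
      ((∑ m : ZMod p, ∑ n : ZMod p, if n ^ 4 = m ^ 4 then (p:ℝ) else 0 : ℝ) : ℂ) := by
    push_cast
    calc _ = ∑ a : ZMod p, ∑ m : ZMod p, ∑ n : ZMod p, ψ (a * (n ^ 4 - m ^ 4)) := by
          refine Finset.sum_congr rfl fun a _ => ?_
          rw [← Complex.conj_mul', map_sum, Finset.sum_mul_sum]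
          refine Finset.sum_congr rfl fun m _ => Finset.sum_congr rfl fun n _ => ?_
          rw [← AddChar.map_neg_eq_conj, ← AddChar.map_add_eq_mul]
          congr 1; ring
      _ = _ := by
          rw [Finset.sum_comm]
          refine Finset.sum_congr rfl fun m _ => ?_
          rw [Finset.sum_comm]
          refine Finset.sum_congr rfl fun n _ => ?_
          rw [AddChar.sum_mulShift _ hprim]
          simp only [sub_eq_zero, ZMod.card]
          split_ifs <;> simp
  rw [Complex.ofReal_injective h1]
  calc _ ≤ ∑ m : ZMod p, (4 * p : ℝ) := by
        refine Finset.sum_le_sum fun m _ => ?_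
        rw [← Finset.sum_filter, Finset.sum_const, nsmul_eq_mul]
        gcongr
        exact_mod_cast card_pow4 p _
    _ = _ := by simp [ZMod.card]; ring

lemma quartic_sum (p : ℕ) [Fact p.Prime] (ψ : AddChar (ZMod p) ℂ) (hψ : ψ ≠ 1) (b : ZMod p) (hb : b ≠ 0) :
    ‖∑ n : ZMod p, ψ (b * n ^ 4)‖ ≤ 9 * √p := by
  set T : ZMod p → ℝ := fun a => ‖∑ n : ZMod p, ψ (a * n ^ 4)‖ ^ 2 with hT
  have hinv : ∀ t : ZMod p, t ≠ 0 → T (b * t ^ 4) = T b := by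
    intro t ht
    simp only [hT]
    congr 2
    rw [← Equiv.sum_comp (Equiv.mulLeft₀ t ht) (fun n => ψ (b * n ^ 4))]
    refine Finset.sum_congr rfl fun n _ => ?_
    congr 1
    simp; ring
  have h1 : ((p:ℝ) - 1) * T b = ∑ t ∈ (Finset.univ.erase (0 : ZMod p)), T (b * t ^ 4) := by
    rw [Finset.sum_congr rfl (fun t ht => hinv t (Finset.ne_of_mem_erase ht)), Finset.sum_const,
      Finset.card_erase_of_mem (Finset.mem_univ _), nsmul_eq_mul, Finset.card_univ, ZMod.card,
      Nat.cast_sub (Fact.out : p.Prime).one_le]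
    simp
  have h2 : ∑ t ∈ (Finset.univ.erase (0 : ZMod p)), T (b * t ^ 4) ≤ ∑ t, T (b * t ^ 4) :=
    Finset.sum_le_sum_of_subset_of_nonneg (Finset.erase_subset _ _) (by intros; positivity)
  have h3 : ∑ t, T (b * t ^ 4) ≤ ∑ a, 4 * T a := by
    rw [← Finset.sum_fiberwise_of_maps_to (s := Finset.univ) (t := Finset.univ)
      (g := fun t : ZMod p => b * t ^ 4) (fun _ _ => Finset.mem_univ _)]
    refine Finset.sum_le_sum fun a _ => ?_
    calc _ = ∑ i : ZMod p with b * i ^ 4 = a, T a := by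
          refine Finset.sum_congr rfl fun i hi => ?_
          simp only [Finset.mem_filter, Finset.mem_univ, true_and] at hi
          rw [hi]
      _ ≤ _ := by
          rw [Finset.sum_const, nsmul_eq_mul]
          have : (Finset.univ.filter (fun i : ZMod p => b * i ^ 4 = a)).card ≤ 4 := by
            refine le_trans (Finset.card_le_card ?_) (card_pow4 p (b⁻¹ * a))
            intro i hi
            simp only [Finset.mem_filter, Finset.mem_univ, true_and] at hi ⊢
            rw [← hi]; field_simp
          have h0 : 0 ≤ T a := by positivity
          gcongr
          exact_mod_cast this
  rw [← Finset.mul_sum] at h3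
  have h4 := second_moment p ψ hψ
  have hp : (2:ℝ) ≤ p := by exact_mod_cast (Fact.out : p.Prime).two_le
  have h5 : ((p:ℝ) - 1) * T b ≤ 16 * (p:ℝ)^2 := by
    rw [h1]; linarith
  have hTb : 0 ≤ T b := by positivity
  have h6 : T b ≤ (9 * √p) ^ 2 := by
    rw [mul_pow, Real.sq_sqrt (by positivity)]
    nlinarith
  exact (pow_le_pow_iff_left₀ (norm_nonneg _) (by positivity) (by norm_num)).1 h6

/-- quartic counting function minus one -/
noncomputable def gG (p : ℕ) [NeZero p] (x : ZMod p) : ℂ :=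
  ((Finset.univ.filter (fun n : ZMod p => n ^ 4 + x = 0)).card : ℂ) - 1

lemma nSol_eq (p : ℕ) [NeZero p] (k : ℤ) :
    nSol k 4 p = (Finset.univ.filter (fun n : ZMod p => n ^ 4 + (k : ZMod p) = 0)).card := by
  unfold nSol
  refine Finset.card_bij (fun n _ => (n : ZMod p)) ?_ ?_ ?_
  · intro n hn
    simp only [Finset.mem_filter, Finset.mem_range, Finset.mem_univ, true_and] at hn ⊢
    have := (ZMod.intCast_zmod_eq_zero_iff_dvd _ p).2 (Int.dvd_of_emod_eq_zero hn.2)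
    push_cast at this
    exact this
  · intro a ha b hb hab
    simp only [Finset.mem_filter, Finset.mem_range] at ha hb
    rw [ZMod.natCast_eq_natCast_iff'] at hab
    rwa [Nat.mod_eq_of_lt ha.1, Nat.mod_eq_of_lt hb.1] at hab
  · intro b hb
    simp only [Finset.mem_filter, Finset.mem_univ, true_and] at hb
    refine ⟨b.val, ?_, by simp⟩
    simp only [Finset.mem_filter, Finset.mem_range, ZMod.val_lt, true_and]
    apply Int.emod_eq_zero_of_dvd
    rw [← ZMod.intCast_zmod_eq_zero_iff_dvd]
    push_cast
    simpa using hb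

lemma nSol_bound (p : ℕ) (hp : p.Prime) (k : ℤ) : |(nSol k 4 p : ℝ) - 1| ≤ 3 := by
  have := Fact.mk hp
  have h : nSol k 4 p ≤ 4 := by
    rw [nSol_eq]
    refine le_trans (Finset.card_le_card ?_) (card_pow4 p (-(k : ZMod p)))
    intro i hi
    simp only [Finset.mem_filter, Finset.mem_univ, true_and] at hi ⊢
    exact eq_neg_of_add_eq_zero_left hi
  have h' : (nSol k 4 p : ℝ) ≤ 4 := by exact_mod_cast h
  rw [abs_le]; constructor <;> linarith [Nat.cast_nonneg (α := ℝ) (nSol k 4 p)]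

lemma gG_sum (p : ℕ) [Fact p.Prime] (ψ : AddChar (ZMod p) ℂ) :
    ∑ x, gG p x * ψ x = ∑ n : ZMod p, ψ ((-1) * n ^ 4) - ∑ x, ψ x := by
  simp only [gG, sub_mul, one_mul, Finset.sum_sub_distrib]
  congr 1
  simp only [Finset.card_filter, Nat.cast_sum, Finset.sum_mul]
  rw [Finset.sum_comm]
  refine Finset.sum_congr rfl fun n _ => ?_
  rw [Finset.sum_eq_single (-1 * n ^ 4)]
  · simp
  · intro b _ hb
    rw [if_neg]; · simp
    intro h; apply hb; linear_combination h
  · simp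

lemma FB_single (p : ℕ) (hp : p.Prime) : haveI : NeZero p := ⟨hp.ne_zero⟩
    FB p (fun k => ((nSol k 4 p : ℝ) - 1 : ℝ)) (9 * √p) 0 := by
  have := Fact.mk hp
  refine ⟨gG p, fun k => ?_, fun ψ => ?_, ?_⟩
  · simp [gG, nSol_eq]
  · rw [gG_sum]
    by_cases h : ψ = 1
    · subst h; simp
    · rw [AddChar.sum_eq_zero_of_ne_one h, sub_zero]
      exact quartic_sum p ψ h _ (by simp)
  · have := gG_sum p 1
    simp at this
    simp [this]

lemma FB_sq (p : ℕ) (hp : p.Prime) : haveI : NeZero p := ⟨hp.ne_zero⟩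
    FB p (fun k => (((nSol k 4 p : ℝ) - 1 : ℝ) : ℂ) * ((nSol k 4 p : ℝ) - 1 : ℝ)) (9 * √p * (9 * √p)) (9 * √p * (9 * √p)) := by
  have := Fact.mk hp
  have hb : ∀ x : ZMod p, ‖gG p x‖ ≤ 3 := by
    intro x
    have := nSol_bound p hp (x.val : ℤ)
    rw [nSol_eq] at this
    simp only [Int.cast_natCast, ZMod.natCast_zmod_val] at this
    rw [← Real.norm_eq_abs, ← Complex.norm_real] at this
    simpa [gG] using this
  have hs : √(p:ℝ) * √p = p := Real.mul_self_sqrt (by positivity)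
  have hb2 : ∀ ψ : AddChar (ZMod p) ℂ, ‖∑ x, gG p x * gG p x * ψ x‖ ≤ 9 * √p * (9 * √p) := by
    intro ψ
    calc _ ≤ ∑ x : ZMod p, (9:ℝ) := by
          refine (norm_sum_le _ _).trans (Finset.sum_le_sum fun x _ => ?_)
          rw [norm_mul, norm_mul, AddChar.norm_apply, mul_one]
          nlinarith [hb x, norm_nonneg (gG p x)]
      _ = 9 * p := by simp [ZMod.card]; ring
      _ ≤ 9 * √p * (9 * √p) := by nlinarith [Nat.cast_nonneg (α := ℝ) p]
  refine ⟨fun x => gG p x * gG p x, fun k => ?_, hb2, ?_⟩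
  · simp [gG, nSol_eq]
  · simpa using hb2 1

lemma pair_bound (q r : ℕ) (hq : Squarefree q) (hr : Squarefree r) (hqr : q ≠ r) (N : ℕ) :
    |∑ k ∈ Finset.Icc 1 N, (∏ p ∈ q.primeFactors, ((nSol (k : ℤ) 4 p : ℝ) - 1)) *
      ∏ p ∈ r.primeFactors, ((nSol (k : ℤ) 4 p : ℝ) - 1)| ≤
      (9 ^ q.primeFactors.card * √q) * (9 ^ r.primeFactors.card * √r) * (1 + Real.log ((q : ℝ) * r)) := by
  set A := q.primeFactors with hA
  set A' := r.primeFactors with hA'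
  have hAq : ∏ p ∈ A, p = q := Nat.prod_primeFactors_of_squarefree hq
  have hAr : ∏ p ∈ A', p = r := Nat.prod_primeFactors_of_squarefree hr
  have hprime : ∀ p ∈ A ∪ A', p.Prime := by
    intro p hp
    rcases Finset.mem_union.1 hp with h | h <;> exact Nat.prime_of_mem_primeFactors h
  let f : ℕ → ℤ → ℂ := fun p k => ((nSol k 4 p : ℝ) - 1 : ℝ)
  let F : ℕ → ℤ → ℂ := fun p k => (if p ∈ A then f p k else 1) * (if p ∈ A' then f p k else 1)
  let B : ℕ → ℝ := fun p => (if p ∈ A then 9 * √p else 1) * (if p ∈ A' then 9 * √p else 1)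
  let Z : ℕ → ℝ := fun p => if p ∈ A ∧ p ∈ A' then 9 * √p * (9 * √p) else 0
  have hFB : ∀ p (hp : p.Prime), p ∈ A ∪ A' → haveI : NeZero p := ⟨hp.ne_zero⟩; FB p (F p) (B p) (Z p) := by
    intro p hp hpu
    have h1 := FB_single p hp
    have h2 := FB_sq p hp
    by_cases hpA : p ∈ A <;> by_cases hpA' : p ∈ A'
    · simpa [F, B, Z, f, hpA, hpA'] using h2
    · simpa [F, B, Z, f, hpA, hpA'] using h1
    · simpa [F, B, Z, f, hpA, hpA'] using h1
    · simp [hpA, hpA'] at hpu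
  have hne : ∏ p ∈ A ∪ A', p ≠ 0 := Finset.prod_ne_zero_iff.2 fun p hp => (hprime p hp).ne_zero
  have : NeZero (∏ p ∈ A ∪ A', p) := ⟨hne⟩
  have key := FB_prod (A ∪ A') hprime F B Z hFB _ rfl
  have hZ : ∏ p ∈ A ∪ A', Z p = 0 := by
    have : ∃ p ∈ A ∪ A', ¬ (p ∈ A ∧ p ∈ A') := by
      by_contra! hcon
      apply hqr
      have : A = A' := by
        ext p
        constructor
        · intro h; exact (hcon p (Finset.mem_union_left _ h)).2
        · intro h; exact (hcon p (Finset.mem_union_right _ h)).1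
      rw [← hAq, ← hAr, this]
    obtain ⟨p, hp, hp2⟩ := this
    exact Finset.prod_eq_zero hp (by simp only [Z]; rw [if_neg hp2])
  rw [hZ] at key
  have hsplit : ∀ (M : Type) [CommMonoid M] (g : ℕ → M), ∏ p ∈ A ∪ A', ((if p ∈ A then g p else 1) * (if p ∈ A' then g p else 1))
      = (∏ p ∈ A, g p) * ∏ p ∈ A', g p := by
    intro M _ g
    rw [Finset.prod_mul_distrib, Finset.prod_ite_mem, Finset.prod_ite_mem, Finset.union_inter_cancel_left,
      Finset.union_inter_cancel_right]
  have hB : ∏ p ∈ A ∪ A', B p = (9 ^ A.card * √q) * (9 ^ A'.card * √r) := by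
    simp only [B]
    rw [hsplit ℝ (fun p => 9 * √p)]
    have hh : ∀ S : Finset ℕ, ∏ p ∈ S, (9 * √(p:ℝ)) = 9 ^ S.card * √((∏ p ∈ S, p : ℕ) : ℝ) := by
      intro S
      rw [Finset.prod_mul_distrib, Finset.prod_const, Nat.cast_prod, Real.sqrt_prod _ (by intros; positivity)]
    rw [hh, hh, hAq, hAr]
  have hF : ∀ k : ℤ, ∏ p ∈ A ∪ A', F p k = (((∏ p ∈ A, ((nSol (k : ℤ) 4 p : ℝ) - 1)) *
      ∏ p ∈ A', ((nSol (k : ℤ) 4 p : ℝ) - 1) : ℝ) : ℂ) := by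
    intro k
    simp only [F]
    rw [hsplit ℂ (fun p => f p k)]
    simp [f]
  have fin := FB_incomplete _ key N
  simp only [hF] at fin
  rw [← Complex.ofReal_sum, Complex.norm_real, Real.norm_eq_abs, hB] at fin
  refine fin.trans ?_
  have hle : ∏ p ∈ A ∪ A', p ≤ q * r := by
    apply Nat.le_of_dvd (Nat.pos_of_ne_zero (mul_ne_zero hq.ne_zero hr.ne_zero))
    rw [← hAq, ← hAr, ← Finset.prod_union_inter]
    exact Dvd.intro _ rfl
  have hlog : Real.log ((∏ p ∈ A ∪ A', p : ℕ) : ℝ) ≤ Real.log ((q:ℝ) * r) := by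
    apply Real.log_le_log
    · exact_mod_cast Nat.pos_of_ne_zero hne
    · exact_mod_cast hle
  gcongr

lemma totient_bound (q : ℕ) (hq : Squarefree q) :
    |(ArithmeticFunction.moebius q : ℝ) / (Nat.totient q : ℝ)| ≤ 2 ^ q.primeFactors.card / q := by
  have hq0 : 0 < q := Nat.pos_of_ne_zero hq.ne_zero
  have hφ : (0:ℝ) < Nat.totient q := by exact_mod_cast Nat.totient_pos.2 hq0
  have h1 : |(ArithmeticFunction.moebius q : ℝ)| ≤ 1 := by
    exact_mod_cast ArithmeticFunction.abs_moebius_le_one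
  have h2 : (q : ℝ) ≤ 2 ^ q.primeFactors.card * Nat.totient q := by
    have h3 := Nat.totient_mul_prod_primeFactors q
    rw [Nat.prod_primeFactors_of_squarefree hq, mul_comm] at h3
    have h4 := Nat.eq_of_mul_eq_mul_left hq0 h3
    have h5 : q ≤ 2 ^ q.primeFactors.card * Nat.totient q := by
      rw [h4, ← Finset.prod_const, ← Finset.prod_mul_distrib]
      conv_lhs => rw [← Nat.prod_primeFactors_of_squarefree hq]
      apply Finset.prod_le_prod'
      intro p hp
      have := (Nat.prime_of_mem_primeFactors hp).two_le
      omega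
    exact_mod_cast h5
  rw [abs_div, abs_of_pos hφ, div_le_div_iff₀ hφ (by exact_mod_cast hq0)]
  nlinarith [abs_nonneg (ArithmeticFunction.moebius q : ℝ)]

lemma g_bound (q : ℕ) (k : ℤ) : |∏ p ∈ q.primeFactors, ((nSol k 4 p : ℝ) - 1)| ≤ 3 ^ q.primeFactors.card := by
  rw [Finset.abs_prod, ← Finset.prod_const]
  exact Finset.prod_le_prod (by intros; positivity)
    (fun p hp => nSol_bound p (Nat.prime_of_mem_primeFactors hp) k)

lemma term_bound (δ : ℝ) (hδ : 0 < δ) : ∃ D : ℝ, 0 < D ∧ ∀ (q r N : ℕ) (y : ℝ), Squarefree q → Squarefree r →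
    (N : ℝ) ≤ y →
    |((ArithmeticFunction.moebius q : ℝ) / (Nat.totient q : ℝ)) *
      ((ArithmeticFunction.moebius r : ℝ) / (Nat.totient r : ℝ)) *
      ∑ k ∈ Finset.Icc 1 N, (∏ p ∈ q.primeFactors, ((nSol (k : ℤ) 4 p : ℝ) - 1)) *
        ∏ p ∈ r.primeFactors, ((nSol (k : ℤ) 4 p : ℝ) - 1)|
    ≤ D * ((if q = r then y * (q : ℝ) ^ (-2 + 2 * δ) else 0)
        + (q : ℝ) ^ (-(1/2) + 2 * δ) * (r : ℝ) ^ (-(1/2) + 2 * δ)) := by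
  obtain ⟨C, hC1, hC⟩ := pow_omega_bound 18 (by norm_num) δ hδ
  refine ⟨C ^ 2 * (1 + 1 / δ), by positivity, fun q r N y hq hr hN => ?_⟩
  have hq0 : (0:ℝ) < q := by exact_mod_cast Nat.pos_of_ne_zero hq.ne_zero
  have hr0 : (0:ℝ) < r := by exact_mod_cast Nat.pos_of_ne_zero hr.ne_zero
  have hy : 0 ≤ y := (Nat.cast_nonneg N).trans hN
  have hw : ∀ n : ℕ, Squarefree n → |(ArithmeticFunction.moebius n : ℝ) / (Nat.totient n : ℝ)| * 9 ^ n.primeFactors.card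
      ≤ C * (n:ℝ) ^ (-1 + δ) := by
    intro n hn
    have hn0 : (0:ℝ) < n := by exact_mod_cast Nat.pos_of_ne_zero hn.ne_zero
    calc _ ≤ (2:ℝ) ^ n.primeFactors.card / n * 9 ^ n.primeFactors.card := by
          gcongr; exact totient_bound n hn
      _ = (18:ℝ) ^ n.primeFactors.card / n := by
          rw [div_mul_eq_mul_div, ← mul_pow]; norm_num
      _ ≤ C * (n:ℝ)^δ / n := by gcongr; exact hC n hn.ne_zero
      _ = _ := by rw [Real.rpow_add hn0, Real.rpow_neg_one]; field_simp
  set wq := (ArithmeticFunction.moebius q : ℝ) / (Nat.totient q : ℝ)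
  set wr := (ArithmeticFunction.moebius r : ℝ) / (Nat.totient r : ℝ)
  rw [abs_mul, abs_mul]
  by_cases hqr : q = r
  · subst hqr
    rw [if_pos rfl]
    have hsum : |∑ k ∈ Finset.Icc 1 N, (∏ p ∈ q.primeFactors, ((nSol (k : ℤ) 4 p : ℝ) - 1)) *
        ∏ p ∈ q.primeFactors, ((nSol (k : ℤ) 4 p : ℝ) - 1)| ≤ y * (9 ^ q.primeFactors.card * 9 ^ q.primeFactors.card) := by
      calc _ ≤ ∑ k ∈ Finset.Icc 1 N, (9 ^ q.primeFactors.card * 9 ^ q.primeFactors.card : ℝ) := by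
            refine (Finset.abs_sum_le_sum_abs _ _).trans (Finset.sum_le_sum fun k _ => ?_)
            rw [abs_mul]
            have h3 : (3:ℝ) ^ q.primeFactors.card ≤ 9 ^ q.primeFactors.card := by gcongr; norm_num
            have := (g_bound q k).trans h3
            gcongr
        _ = N * (9 ^ q.primeFactors.card * 9 ^ q.primeFactors.card) := by simp
        _ ≤ _ := by gcongr
    calc _ ≤ |wq| * |wq| * (y * (9 ^ q.primeFactors.card * 9 ^ q.primeFactors.card)) := by gcongr
      _ = y * ((|wq| * 9 ^ q.primeFactors.card) * (|wq| * 9 ^ q.primeFactors.card)) := by ring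
      _ ≤ y * ((C * (q:ℝ) ^ (-1 + δ)) * (C * (q:ℝ) ^ (-1 + δ))) := by
          have := hw q hq
          gcongr
      _ = C ^ 2 * 1 * (y * (q : ℝ) ^ (-2 + 2 * δ) + 0) := by
          have h7 : (q : ℝ) ^ (-2 + 2 * δ) = (q:ℝ) ^ (-1 + δ) * (q:ℝ) ^ (-1 + δ) := by
            rw [← Real.rpow_add hq0]; congr 1; ring
          rw [h7]; ring
      _ ≤ _ := by
          gcongr
          · have : 0 ≤ 1 / δ := by positivity
            linarith
          · positivity
  · rw [if_neg hqr, zero_add]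
    have h1 : (1:ℝ) ≤ (q:ℝ) * r := by
      exact_mod_cast Nat.one_le_iff_ne_zero.2 (mul_ne_zero hq.ne_zero hr.ne_zero)
    have hlog : 1 + Real.log ((q:ℝ) * r) ≤ (1 + 1/δ) * ((q:ℝ)^δ * (r:ℝ)^δ) := by
      rw [← Real.mul_rpow hq0.le hr0.le]
      have a1 := Real.log_le_rpow_div (x := (q:ℝ) * r) (by positivity) hδ
      have a2 := Real.one_le_rpow h1 hδ.le
      rw [add_mul, one_mul, one_div_mul_eq_div]
      linarith
    have hlog0 : 0 ≤ 1 + Real.log ((q:ℝ) * r) := by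
      have := Real.log_nonneg h1
      linarith
    have hcomb : ∀ n : ℝ, 0 < n → n ^ (-(1/2) + 2 * δ) = n ^ (-1 + δ) * √n * n ^ δ := by
      intro n hn
      rw [Real.sqrt_eq_rpow, ← Real.rpow_add hn, ← Real.rpow_add hn]
      congr 1; ring
    calc _ ≤ |wq| * |wr| * ((9 ^ q.primeFactors.card * √q) * (9 ^ r.primeFactors.card * √r) * (1 + Real.log ((q : ℝ) * r))) := by
          gcongr
          exact pair_bound q r hq hr hqr N
      _ = (|wq| * 9 ^ q.primeFactors.card) * (|wr| * 9 ^ r.primeFactors.card) * (√q * √r) * (1 + Real.log ((q : ℝ) * r)) := by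
          ring
      _ ≤ (C * (q:ℝ) ^ (-1 + δ)) * (C * (r:ℝ) ^ (-1 + δ)) * (√q * √r) * ((1 + 1/δ) * ((q:ℝ)^δ * (r:ℝ)^δ)) := by
          have a1 := hw q hq
          have a2 := hw r hr
          gcongr
      _ = _ := by
          rw [hcomb q hq0, hcomb r hr0]; ring

theorem stmt13 (ε : ℝ) (hε : 0 < ε) :
    ∃ C > 0, ∀ y Q₁ U : ℝ, 2 ≤ y → 1 ≤ Q₁ → Q₁ < U →
      ∑ k ∈ Finset.Icc 1 ⌊y⌋₊,
        |∑ q ∈ (Finset.Icc 1 ⌊U⌋₊).filter (fun q => Squarefree q ∧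
              (∀ p : ℕ, p.Prime → p ∣ q → p % 4 = 1) ∧ Q₁ < (q : ℝ)),
            ((ArithmeticFunction.moebius q : ℝ) / (Nat.totient q : ℝ)) *
              ∏ p ∈ q.primeFactors, ((nSol (k : ℤ) 4 p : ℝ) - 1)| ^ 2
        ≤ C * (y * Q₁ ^ (-(1 - ε)) + U ^ (1 + ε)) := by
  set η := min ε 1 with hη
  have hη0 : 0 < η := lt_min hε one_pos
  have hη1 : η ≤ 1 := min_le_right _ _
  have hηε : η ≤ ε := min_le_left _ _
  obtain ⟨D, hD, hterm⟩ := term_bound (η / 8) (by positivity)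
  have hsummable : Summable (fun n : ℕ => (n : ℝ) ^ (-(1 + η / 4))) :=
    Real.summable_nat_rpow.2 (by linarith)
  set S := ∑' n : ℕ, (n : ℝ) ^ (-(1 + η / 4)) with hS
  have hS0 : 0 ≤ S := tsum_nonneg fun n => by positivity
  refine ⟨D * (S + S ^ 2 + 1), by positivity, fun y Q₁ U hy hQ hU => ?_⟩
  set Ω := (Finset.Icc 1 ⌊U⌋₊).filter (fun q => Squarefree q ∧
              (∀ p : ℕ, p.Prime → p ∣ q → p % 4 = 1) ∧ Q₁ < (q : ℝ)) with hΩ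
  have hU0 : 0 ≤ U := by linarith
  have hSle : ∑ q ∈ Ω, (q : ℝ) ^ (-(1 + η / 4)) ≤ S :=
    hsummable.sum_le_tsum _ (fun n _ => by positivity)
  have hmem : ∀ q ∈ Ω, Squarefree q ∧ Q₁ < (q:ℝ) ∧ (q:ℝ) ≤ U := by
    intro q hq
    simp only [hΩ, Finset.mem_filter, Finset.mem_Icc] at hq
    exact ⟨hq.2.1, hq.2.2.2, (Nat.le_floor_iff hU0).1 hq.1.2⟩
  let w : ℕ → ℝ := fun q => (ArithmeticFunction.moebius q : ℝ) / (Nat.totient q : ℝ)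
  let g : ℕ → ℕ → ℝ := fun q k => ∏ p ∈ q.primeFactors, ((nSol (k : ℤ) 4 p : ℝ) - 1)
  have hexp : ∑ k ∈ Finset.Icc 1 ⌊y⌋₊, |∑ q ∈ Ω, w q * g q k| ^ 2 =
      ∑ q ∈ Ω, ∑ r ∈ Ω, w q * w r * ∑ k ∈ Finset.Icc 1 ⌊y⌋₊, g q k * g r k := by
    simp_rw [sq_abs, sq, Finset.sum_mul_sum, Finset.mul_sum]
    rw [Finset.sum_comm]
    refine Finset.sum_congr rfl fun q _ => ?_
    rw [Finset.sum_comm]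
    refine Finset.sum_congr rfl fun r _ => Finset.sum_congr rfl fun k _ => ?_
    ring
  have hNy : ((⌊y⌋₊ : ℕ) : ℝ) ≤ y := Nat.floor_le (by linarith)
  have hA : ∑ q ∈ Ω, (q : ℝ) ^ (-2 + 2 * (η/8)) ≤ Q₁ ^ (-(1 - ε)) * S := by
    calc _ ≤ ∑ q ∈ Ω, Q₁ ^ (-(1 - ε)) * (q : ℝ) ^ (-(1 + η / 4)) := by
          refine Finset.sum_le_sum fun q hq => ?_
          obtain ⟨_, h2, _⟩ := hmem q hq
          have hq1 : (1:ℝ) ≤ q := by linarith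
          calc (q : ℝ) ^ (-2 + 2 * (η/8)) ≤ (q : ℝ) ^ (-(1 - η) + -(1 + η / 4)) :=
                Real.rpow_le_rpow_of_exponent_le hq1 (by linarith)
            _ = (q : ℝ) ^ (-(1 - η)) * (q : ℝ) ^ (-(1 + η / 4)) := Real.rpow_add (by linarith) _ _
            _ ≤ Q₁ ^ (-(1 - η)) * (q : ℝ) ^ (-(1 + η / 4)) := by
                apply mul_le_mul_of_nonneg_right _ (by positivity)
                exact Real.rpow_le_rpow_of_nonpos (by linarith) h2.le (by linarith)
            _ ≤ _ := by
                apply mul_le_mul_of_nonneg_right _ (by positivity)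
                exact Real.rpow_le_rpow_of_exponent_le hQ (by linarith)
      _ = Q₁ ^ (-(1 - ε)) * ∑ q ∈ Ω, (q : ℝ) ^ (-(1 + η / 4)) := by rw [Finset.mul_sum]
      _ ≤ _ := by gcongr
  have hB : ∑ q ∈ Ω, (q : ℝ) ^ (-(1/2) + 2 * (η/8)) ≤ U ^ ((1 + η) / 2) * S := by
    calc _ ≤ ∑ q ∈ Ω, U ^ ((1 + η) / 2) * (q : ℝ) ^ (-(1 + η / 4)) := by
          refine Finset.sum_le_sum fun q hq => ?_
          obtain ⟨_, h2, h3⟩ := hmem q hq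
          have hq1 : (1:ℝ) ≤ q := by linarith
          calc (q : ℝ) ^ (-(1/2) + 2 * (η/8)) = (q : ℝ) ^ ((1 + η) / 2 + -(1 + η / 4)) := by
                congr 1; ring
            _ = (q : ℝ) ^ ((1 + η) / 2) * (q : ℝ) ^ (-(1 + η / 4)) := Real.rpow_add (by linarith) _ _
            _ ≤ _ := by gcongr
      _ = U ^ ((1 + η) / 2) * ∑ q ∈ Ω, (q : ℝ) ^ (-(1 + η / 4)) := by rw [Finset.mul_sum]
      _ ≤ _ := by gcongr
  have hUU : (U ^ ((1 + η) / 2)) ^ 2 ≤ U ^ (1 + ε) := by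
    rw [← Real.rpow_natCast, ← Real.rpow_mul hU0]
    apply Real.rpow_le_rpow_of_exponent_le (by linarith)
    push_cast
    linarith
  change ∑ k ∈ Finset.Icc 1 ⌊y⌋₊, |∑ q ∈ Ω, w q * g q k| ^ 2 ≤ _
  rw [hexp]
  have hQ0 : 0 ≤ Q₁ := by linarith
  have hB0 : 0 ≤ ∑ q ∈ Ω, (q : ℝ) ^ (-(1/2) + 2 * (η/8)) := Finset.sum_nonneg fun q _ => by positivity
  calc _ ≤ ∑ q ∈ Ω, ∑ r ∈ Ω, D * ((if q = r then y * (q : ℝ) ^ (-2 + 2 * (η/8)) else 0)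
        + (q : ℝ) ^ (-(1/2) + 2 * (η/8)) * (r : ℝ) ^ (-(1/2) + 2 * (η/8))) := by
        refine Finset.sum_le_sum fun q hq => Finset.sum_le_sum fun r hr => ?_
        exact (le_abs_self _).trans (hterm q r _ y (hmem q hq).1 (hmem r hr).1 hNy)
    _ = D * (y * ∑ q ∈ Ω, (q : ℝ) ^ (-2 + 2 * (η/8)) + (∑ q ∈ Ω, (q : ℝ) ^ (-(1/2) + 2 * (η/8))) ^ 2) := by
        rw [sq, Finset.sum_mul_sum, Finset.mul_sum Ω _ y, ← Finset.sum_add_distrib, Finset.mul_sum]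
        refine Finset.sum_congr rfl fun q hq => ?_
        rw [← Finset.mul_sum, Finset.sum_add_distrib, Finset.sum_ite_eq, if_pos hq]
    _ ≤ D * (y * (Q₁ ^ (-(1 - ε)) * S) + (U ^ ((1 + η) / 2) * S) ^ 2) := by gcongr
    _ = D * (S * (y * Q₁ ^ (-(1 - ε))) + S ^ 2 * (U ^ ((1 + η) / 2)) ^ 2) := by ring
    _ ≤ D * (S * (y * Q₁ ^ (-(1 - ε))) + S ^ 2 * U ^ (1 + ε)) := by gcongr
    _ ≤ D * (S + S ^ 2 + 1) * (y * Q₁ ^ (-(1 - ε)) + U ^ (1 + ε)) := by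
        have h1 : 0 ≤ y * Q₁ ^ (-(1 - ε)) := by positivity
        have h2 : 0 ≤ U ^ (1 + ε) := by positivity
        rw [mul_assoc]
        gcongr
        have h3 : 0 ≤ S ^ 2 := by positivity
        nlinarith [mul_nonneg hS0 h2, mul_nonneg h3 h1]
end
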